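/- Let S be one of the following structures of n×n complex pencils L(λ)=A+λB: skew-Hermitian (A^*=−A, B^*=−B), *-even (A^*=A, B^*=−B), *-odd (A^*=−A, B^*=B), *-palindromic (A^*=B), or *-anti-palindromic (A^*=−B). Let L(λ) be a regular n×n pencil with structure S whose pairwise distinct (finite or infinite) eigenvalues are λ_1,…,λ_κ with partial multiplicities n_{i,1} ≥ … ≥ n_{i,g_i} > 0. Let r ≥ 1, let 0 ≤ s ≤ ⌊r/2⌋, set ℓ = r−2s, and let Φ_s be the S-structured parameterization map defined in the context, whose parameter space ℝ^{2ℓ} × ℂ^{(r+s)n} is identified with ℝ^{2ℓ+2(r+s)n}. Then there exists a generic set G_s ⊆ ℝ^{2ℓ+2(r+s)n} such that for every parameter tuple in G_s, writing E = Φ_s of that tuple: (a) L+E is a regular pencil; (b) for each i = 1,…,κ, the partial multiplicities of L+E at λ_i are exactly n_{i,r+1} ≥ … ≥ n_{i,g_i} (in particular, if r ≥ g_i then λ_i is not an eigenvalue of L+E); (c) every (finite or infinite) eigenvalue of L+E that is not an eigenvalue of L is simple. -/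

import Mathlib

open Matrix Polynomial BigOperators

/-- The determinant of the pencil `A + λ B`, as a polynomial in `λ`. -/
noncomputable def pencilPoly (n : ℕ) (A B : Matrix (Fin n) (Fin n) ℂ) : Polynomial ℂ :=
  (A.map Polynomial.C + (Polynomial.X : Polynomial ℂ) • B.map Polynomial.C).det

/-- A pencil is regular if its determinant is not the zero polynomial. -/
def PencilRegular (n : ℕ) (A B : Matrix (Fin n) (Fin n) ℂ) : Prop :=
  pencilPoly n A B ≠ 0

/-- The order of vanishing of a polynomial at a point (`⊤` for the zero polynomial). -/
noncomputable def orderVan (p : Polynomial ℂ) (z : ℂ) : ℕ∞ :=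
  if p = 0 then ⊤ else (p.rootMultiplicity z : ℕ∞)

/-- `m_k(z)`: the minimum over all `k × k` submatrices `S(λ)` of `A + λB` of the order
of vanishing of `det S(λ)` at `z`. -/
noncomputable def minorOrder (n k : ℕ) (A B : Matrix (Fin n) (Fin n) ℂ) (z : ℂ) : ℕ∞ :=
  ⨅ (f : Fin k ↪ Fin n) (g : Fin k ↪ Fin n),
    orderVan (((A.map Polynomial.C + (Polynomial.X : Polynomial ℂ) • B.map Polynomial.C).submatrix f g).det) z

/-- The multiset of partial multiplicities of the pencil `A + λB` at the finite point
`z`: the positive values among `m_k(z) − m_{k−1}(z)`, `k = 1, …, n`. -/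
noncomputable def pmFin (n : ℕ) (A B : Matrix (Fin n) (Fin n) ℂ) (z : ℂ) : Multiset ℕ :=
  ((Multiset.range n).map fun k =>
    (minorOrder n (k + 1) A B z - minorOrder n k A B z).toNat).filter (fun m => 0 < m)

/-- The multiset of partial multiplicities of the pencil `A + λB` at a finite point
(`some z`) or at infinity (`none`, via the reversal pencil `B + λA` at `0`). -/
noncomputable def pmAt (n : ℕ) (A B : Matrix (Fin n) (Fin n) ℂ) : Option ℂ → Multiset ℕ
  | some z => pmFin n A B z
  | none => pmFin n B A 0

/-- `μ` (finite or infinite) is an eigenvalue of the pencil `A + λB` iff the list of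
partial multiplicities at `μ` is nonempty. -/
def IsEigenvalue (n : ℕ) (A B : Matrix (Fin n) (Fin n) ℂ) (μ : Option ℂ) : Prop :=
  pmAt n A B μ ≠ 0

/-- The algebraic multiplicity of a finite (`some z`) or infinite (`none`) eigenvalue. -/
noncomputable def algMultAt (n : ℕ) (A B : Matrix (Fin n) (Fin n) ℂ) : Option ℂ → ℕ
  | some z => (pencilPoly n A B).rootMultiplicity z
  | none => (pencilPoly n B A).rootMultiplicity 0

/-- A subset of `ι → ℂ` (i.e. `ℂ^N`, `N = #ι`) is generic if its complement is
contained in the common zero set of finitely many polynomials that are not all zero. -/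
def IsGenericC (ι : Type) [Fintype ι] (G : Set (ι → ℂ)) : Prop :=
  ∃ S : Finset (MvPolynomial ι ℂ), (∃ p ∈ S, p ≠ 0) ∧
    Gᶜ ⊆ { x | ∀ p ∈ S, MvPolynomial.eval x p = 0 }

/-- A subset of `ι → ℝ` (i.e. `ℝ^N`, `N = #ι`) is generic if its complement is
contained in the common zero set of finitely many real polynomials that are not all zero. -/
def IsGenericR (ι : Type) [Fintype ι] (G : Set (ι → ℝ)) : Prop :=
  ∃ S : Finset (MvPolynomial ι ℝ), (∃ p ∈ S, p ≠ 0) ∧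
    Gᶜ ⊆ { x | ∀ p ∈ S, MvPolynomial.eval x p = 0 }

/-- The five symmetry structures (with respect to the conjugate transpose). -/
inductive StructClass : Type
  | skewHermitian | starEven | starOdd | starPalindromic | starAntiPalindromic

/-- The pencil `A + λB` has the given symmetry structure. -/
def HasStruct (n : ℕ) : StructClass → Matrix (Fin n) (Fin n) ℂ → Matrix (Fin n) (Fin n) ℂ → Prop
  | .skewHermitian, A, B => Aᴴ = -A ∧ Bᴴ = -B
  | .starEven, A, B => Aᴴ = A ∧ Bᴴ = -B
  | .starOdd, A, B => Aᴴ = -A ∧ Bᴴ = B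
  | .starPalindromic, A, B => Aᴴ = B
  | .starAntiPalindromic, A, B => Aᴴ = -B

/-- Index type for the complex parameters: coordinates of the vectors
`u_1,…,u_ℓ, v_1,…,v_s, γ_1,…,γ_s, δ_1,…,δ_s ∈ ℂ^n` ((ℓ + 3s)n = (r+s)n coordinates). -/
abbrev IdxC (l s n : ℕ) : Type := (Fin l ⊕ (Fin s ⊕ Fin s ⊕ Fin s)) × Fin n

/-- Real parameter space `ℝ^{2ℓ} × ℂ^{(r+s)n}` identified with `ℝ^{2ℓ+2(r+s)n}`:
the reals `a_1, b_1, …, a_ℓ, b_ℓ` together with real and imaginary parts of the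
complex coordinates. -/
abbrev IdxR (l s n : ℕ) : Type := (Fin l ⊕ Fin l) ⊕ (IdxC l s n ⊕ IdxC l s n)

/-- The complex vector entry encoded by real and imaginary parts. -/
noncomputable def cEnt {l s n : ℕ} (y : IdxR l s n → ℝ) (t : IdxC l s n) : ℂ :=
  (y (.inr (.inl t)) : ℂ) + (y (.inr (.inr t)) : ℂ) * Complex.I

/-- Constant coefficient of the structured pencil `Φ_s(y)(λ)` for each structure. -/
noncomputable def PhiStA (n l s : ℕ) (sc : StructClass) (y : IdxR l s n → ℝ) :
    Matrix (Fin n) (Fin n) ℂ :=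
  let a : Fin l → ℂ := fun i => ((y (.inl (.inl i)) : ℝ) : ℂ)
  let b : Fin l → ℂ := fun i => ((y (.inl (.inr i)) : ℝ) : ℂ)
  let u : Fin l → Fin n → ℂ := fun i k => cEnt y (.inl i, k)
  let v : Fin s → Fin n → ℂ := fun j k => cEnt y (.inr (.inl j), k)
  let γ : Fin s → Fin n → ℂ := fun j k => cEnt y (.inr (.inr (.inl j)), k)
  let δ : Fin s → Fin n → ℂ := fun j k => cEnt y (.inr (.inr (.inr j)), k)
  match sc with
  | .skewHermitian =>
      (∑ i, (Complex.I * a i) • Matrix.vecMulVec (u i) (star (u i)))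
      + ∑ j, (Matrix.vecMulVec (v j) (star (γ j)) - Matrix.vecMulVec (γ j) (star (v j)))
  | .starEven =>
      (∑ i, (a i) • Matrix.vecMulVec (u i) (star (u i)))
      + ∑ j, (Matrix.vecMulVec (v j) (star (γ j)) + Matrix.vecMulVec (γ j) (star (v j)))
  | .starOdd =>
      (∑ i, (Complex.I * a i) • Matrix.vecMulVec (u i) (star (u i)))
      + ∑ j, (Matrix.vecMulVec (v j) (star (γ j)) - Matrix.vecMulVec (γ j) (star (v j)))
  | .starPalindromic =>
      (∑ i, (a i - Complex.I * b i) • Matrix.vecMulVec (u i) (star (u i)))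
      + ∑ j, (Matrix.vecMulVec (v j) (star (γ j)) + Matrix.vecMulVec (δ j) (star (v j)))
  | .starAntiPalindromic =>
      (∑ i, (a i + Complex.I * b i) • Matrix.vecMulVec (u i) (star (u i)))
      + ∑ j, (Matrix.vecMulVec (v j) (star (γ j)) - Matrix.vecMulVec (δ j) (star (v j)))

/-- Coefficient of `λ` in the structured pencil `Φ_s(y)(λ)` for each structure. -/
noncomputable def PhiStB (n l s : ℕ) (sc : StructClass) (y : IdxR l s n → ℝ) :
    Matrix (Fin n) (Fin n) ℂ :=
  let a : Fin l → ℂ := fun i => ((y (.inl (.inl i)) : ℝ) : ℂ)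
  let b : Fin l → ℂ := fun i => ((y (.inl (.inr i)) : ℝ) : ℂ)
  let u : Fin l → Fin n → ℂ := fun i k => cEnt y (.inl i, k)
  let v : Fin s → Fin n → ℂ := fun j k => cEnt y (.inr (.inl j), k)
  let γ : Fin s → Fin n → ℂ := fun j k => cEnt y (.inr (.inr (.inl j)), k)
  let δ : Fin s → Fin n → ℂ := fun j k => cEnt y (.inr (.inr (.inr j)), k)
  match sc with
  | .skewHermitian =>
      (∑ i, (Complex.I * b i) • Matrix.vecMulVec (u i) (star (u i)))
      + ∑ j, (Matrix.vecMulVec (v j) (star (δ j)) - Matrix.vecMulVec (δ j) (star (v j)))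
  | .starEven =>
      (∑ i, (Complex.I * b i) • Matrix.vecMulVec (u i) (star (u i)))
      + ∑ j, (Matrix.vecMulVec (v j) (star (δ j)) - Matrix.vecMulVec (δ j) (star (v j)))
  | .starOdd =>
      (∑ i, (b i) • Matrix.vecMulVec (u i) (star (u i)))
      + ∑ j, (Matrix.vecMulVec (v j) (star (δ j)) + Matrix.vecMulVec (δ j) (star (v j)))
  | .starPalindromic =>
      (∑ i, (a i + Complex.I * b i) • Matrix.vecMulVec (u i) (star (u i)))
      + ∑ j, (Matrix.vecMulVec (v j) (star (δ j)) + Matrix.vecMulVec (γ j) (star (v j)))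
  | .starAntiPalindromic =>
      (∑ i, (-(a i) + Complex.I * b i) • Matrix.vecMulVec (u i) (star (u i)))
      + ∑ j, (Matrix.vecMulVec (v j) (star (δ j)) - Matrix.vecMulVec (γ j) (star (v j)))

section Minors

variable {R : Type*} [CommRing R] {ι κ ι' : Type*}

/-- Every `k × k` minor of `M` is divisible by `q`. -/
def MinorsDvd (q : R) (k : ℕ) (M : Matrix ι κ R) : Prop :=
  ∀ (f : Fin k → ι) (g : Fin k → κ), q ∣ (M.submatrix f g).det

theorem MinorsDvd.transpose {q : R} {k : ℕ} {M : Matrix ι κ R} (h : MinorsDvd q k M) :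
    MinorsDvd q k Mᵀ := fun f g => by
  rw [← det_transpose]
  exact h g f

theorem MinorsDvd.mul_left [Fintype ι] {q : R} {k : ℕ} {M : Matrix ι κ R}
    (h : MinorsDvd q k M) (P : Matrix ι' ι R) : MinorsDvd q k (P * M) := by
  classical
  intro f g
  have e : ((P * M).submatrix f g).det = (detRowAlternating (R := R)).toMultilinearMap
      (fun i : Fin k => ∑ j : ι, P (f i) j • fun c => M j (g c)) := by
    change det _ = det _
    congr 1
    ext i c
    simp [Matrix.mul_apply, Finset.sum_apply]
  rw [e, MultilinearMap.map_sum]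
  refine Finset.dvd_sum fun φ _ => ?_
  rw [MultilinearMap.map_smul_univ, smul_eq_mul]
  exact Dvd.dvd.mul_left (h φ g) _

theorem MinorsDvd.mul_right [Fintype κ] {q : R} {k : ℕ} {M : Matrix ι κ R}
    (h : MinorsDvd q k M) (P : Matrix κ ι' R) : MinorsDvd q k (M * P) := by
  have := (h.transpose.mul_left Pᵀ).transpose
  rwa [← Matrix.transpose_mul, Matrix.transpose_transpose] at this

theorem MinorsDvd.succ {q : R} {k : ℕ} {M : Matrix ι κ R} (h : MinorsDvd q k M) :
    MinorsDvd q (k + 1) M := by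
  intro f g
  rw [det_succ_row_zero]
  refine Finset.dvd_sum fun j _ => Dvd.dvd.mul_left ?_ _
  rw [submatrix_submatrix]
  exact h _ _

/-- The matrix determinant lemma over a commutative ring, in terms of row replacement. -/
theorem det_add_vecMulVec_eq_add_sum [Fintype ι] [DecidableEq ι] (M : Matrix ι ι R)
    (x y : ι → R) :
    (M + vecMulVec x y).det = M.det + ∑ i, x i * (M.updateRow i y).det := by
  suffices H : ∀ S : Finset ι, (M + vecMulVec (fun i => if i ∈ S then x i else 0) y).det
      = M.det + ∑ i ∈ S, x i * (M.updateRow i y).det by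
    simpa using H Finset.univ
  intro S
  induction S using Finset.induction_on with
  | empty =>
    have : vecMulVec (fun _ : ι => (0 : R)) y = 0 := by ext; simp [vecMulVec_apply]
    simp [this]
  | insert a S ha ih =>
    have e : M + vecMulVec (fun i => if i ∈ insert a S then x i else 0) y
        = (M + vecMulVec (fun i => if i ∈ S then x i else 0) y).updateRow a
          ((M + vecMulVec (fun i => if i ∈ S then x i else 0) y) a + x a • y) := by
      ext i j
      by_cases hi : i = a
      · subst hi
        simp [vecMulVec_apply, ha]
      · simp [vecMulVec_apply, hi]
    rw [e, det_updateRow_add, updateRow_eq_self, ih, det_updateRow_smul, Finset.sum_insert ha]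
    have e2 : ((M + vecMulVec (fun i => if i ∈ S then x i else 0) y).updateRow a y).det
        = (M.updateRow a y).det := by
      refine det_eq_of_forall_row_eq_smul_add_const (fun i => if i ∈ S then x i else 0) a
        (by simp [ha]) fun i j => ?_
      by_cases hi : i = a
      · subst hi
        simp [ha]
      · simp [vecMulVec_apply, hi]
    rw [e2]
    ring

theorem dvd_det_updateRow {q : R} {k : ℕ} {M : Matrix ι κ R} (h : MinorsDvd q k M)
    (f : Fin (k + 1) → ι) (g : Fin (k + 1) → κ) (i : Fin (k + 1)) (y : Fin (k + 1) → R) :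
    q ∣ ((M.submatrix f g).updateRow i y).det := by
  rw [det_succ_row _ i]
  refine Finset.dvd_sum fun j _ => Dvd.dvd.mul_left ?_ _
  rw [submatrix_updateRow_succAbove, submatrix_submatrix]
  exact h _ _

theorem MinorsDvd.add_vecMulVec {q : R} {k : ℕ} {M : Matrix ι κ R} (h : MinorsDvd q k M)
    (x : ι → R) (y : κ → R) : MinorsDvd q (k + 1) (M + vecMulVec x y) := by
  intro f g
  have e : (M + vecMulVec x y).submatrix f g
      = M.submatrix f g + vecMulVec (x ∘ f) (y ∘ g) := by
    ext; simp [vecMulVec_apply]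
  rw [e, det_add_vecMulVec_eq_add_sum]
  exact dvd_add (h.succ f g)
    (Finset.dvd_sum fun i _ => Dvd.dvd.mul_left (dvd_det_updateRow h f g i _) _)

theorem MinorsDvd.add_sum_vecMulVec {q : R} {k : ℕ} {M : Matrix ι κ R}
    (h : MinorsDvd q k M) {σ : Type*} (S : Finset σ) (x : σ → ι → R) (y : σ → κ → R) :
    MinorsDvd q (k + S.card) (M + ∑ c ∈ S, vecMulVec (x c) (y c)) := by
  classical
  induction S using Finset.induction_on with
  | empty => simpa using h
  | insert a S ha ih =>
    rw [Finset.sum_insert ha, Finset.card_insert_of_notMem ha, add_comm (vecMulVec _ _),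
      ← add_assoc, ← add_assoc]
    exact ih.add_vecMulVec _ _

end Minors

section Smith

variable {R : Type*} [CommRing R] [IsDomain R]

/-- Smith normal form of a nonsingular square matrix over a principal ideal domain
(without the divisibility chain of the diagonal entries). -/
theorem exists_isUnit_mul_eq_mul_diagonal [IsPrincipalIdealRing R] {ι : Type*} [Fintype ι]
    [DecidableEq ι] (M : Matrix ι ι R) (hM : M.det ≠ 0) :
    ∃ (P Q : Matrix ι ι R) (a : ι → R), IsUnit P ∧ IsUnit Q ∧ M * Q = P * diagonal a := by
  have hinj : Function.Injective (Matrix.toLin' M) := by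
    rw [← LinearMap.ker_eq_bot, Matrix.ker_toLin'_eq_bot_iff]
    intro v hv
    exact Matrix.eq_zero_of_mulVec_eq_zero hM hv
  let E := LinearEquiv.ofInjective (Matrix.toLin' M) hinj
  obtain ⟨b, a, c, hc⟩ := Submodule.exists_smith_normal_form_of_rank_eq (Pi.basisFun R ι)
    (N := LinearMap.range (Matrix.toLin' M)) (LinearEquiv.finrank_eq E).symm
  let d := c.map E.symm
  have hd : ∀ i, M *ᵥ (d i) = a i • b i := fun i => by
    rw [← hc i, ← Matrix.toLin'_apply]
    change ((E (E.symm (c i)) : LinearMap.range (Matrix.toLin' M)) : ι → R) = _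
    rw [LinearEquiv.apply_symm_apply]
  refine ⟨(Pi.basisFun R ι).toMatrix b, (Pi.basisFun R ι).toMatrix d, a, ?_, ?_, ?_⟩
  · exact isUnit_iff_exists.mpr ⟨_, (Pi.basisFun R ι).toMatrix_mul_toMatrix_flip b,
      b.toMatrix_mul_toMatrix_flip (Pi.basisFun R ι)⟩
  · exact isUnit_iff_exists.mpr ⟨_, (Pi.basisFun R ι).toMatrix_mul_toMatrix_flip d,
      d.toMatrix_mul_toMatrix_flip (Pi.basisFun R ι)⟩
  · ext i j
    have := congrFun (hd j) i
    rw [Matrix.mul_diagonal]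
    simpa [Matrix.mul_apply, Matrix.mulVec, dotProduct, Module.Basis.toMatrix_apply,
      mul_comm] using this

theorem sum_range_le_sum_of_injective {n k : ℕ} {e : ℕ → ℕ}
    (he : ∀ i j, i ≤ j → j < n → e i ≤ e j) {φ : Fin k → ℕ} (hφ : Function.Injective φ)
    (hn : ∀ i, φ i < n) : ∑ i ∈ Finset.range k, e i ≤ ∑ i, e (φ i) := by
  classical
  let T := Finset.univ.image φ
  have hT : T.card = k := by
    rw [Finset.card_image_of_injective _ hφ, Finset.card_univ, Fintype.card_fin]
  have h1 : ∑ i, e (φ i) = ∑ t ∈ T, e t := by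
    rw [Finset.sum_image fun _ _ _ _ h => hφ h]
  have h2 : ∑ t ∈ T, e t = ∑ i, e (T.orderEmbOfFin hT i) := by
    rw [← Finset.sum_coe_sort T, ← (T.orderIsoOfFin hT).toEquiv.sum_comp]
    rfl
  rw [h1, h2, Finset.sum_range]
  refine Finset.sum_le_sum fun i _ => ?_
  refine he _ _ ?_ ?_
  · have hm : StrictMono (T.orderEmbOfFin hT) := (T.orderEmbOfFin hT).strictMono
    obtain ⟨i, hi⟩ := i
    induction i with
    | zero => exact Nat.zero_le _
    | succ i ih =>
      exact Nat.succ_le_of_lt (lt_of_le_of_lt (ih (by lia) (Finset.mem_univ _))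
        (hm (show (⟨i, by lia⟩ : Fin k) < ⟨i + 1, hi⟩ by simp)))
  · obtain ⟨j, _, hj⟩ := Finset.mem_image.mp (T.orderEmbOfFin_mem hT i)
    rw [← hj]
    exact hn j

theorem X_sub_C_pow_dvd_prod_iff {σ : Type*} (S : Finset σ) (a : σ → R[X])
    (ha : ∀ i ∈ S, a i ≠ 0) (z : R) (m : ℕ) :
    (X - C z) ^ m ∣ ∏ i ∈ S, a i ↔ m ≤ ∑ i ∈ S, (a i).rootMultiplicity z := by
  classical
  rw [← le_rootMultiplicity_iff (Finset.prod_ne_zero_iff.mpr ha)]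
  suffices (∏ i ∈ S, a i).rootMultiplicity z = ∑ i ∈ S, (a i).rootMultiplicity z by rw [this]
  simp only [← count_roots]
  rw [roots_prod _ _ (Finset.prod_ne_zero_iff.mpr ha), Multiset.count_bind]
  rfl

theorem minorsDvd_diagonal_iff {n k : ℕ} (hk : k ≤ n) (a : Fin n → R[X])
    (ha : ∀ i, a i ≠ 0) (z : R) (σ : Equiv.Perm (Fin n)) (e : ℕ → ℕ)
    (he : ∀ i j, i ≤ j → j < n → e i ≤ e j)
    (hea : ∀ i, (a (σ i)).rootMultiplicity z = e i) (m : ℕ) :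
    MinorsDvd ((X - C z) ^ m) k (diagonal a) ↔ m ≤ ∑ i ∈ Finset.range k, e i := by
  constructor
  · intro h
    have h1 := h (σ ∘ Fin.castLE hk) (σ ∘ Fin.castLE hk)
    rw [submatrix_diagonal _ _ (σ.injective.comp (Fin.castLE_injective hk)), det_diagonal,
      X_sub_C_pow_dvd_prod_iff _ (a ∘ σ ∘ Fin.castLE hk) (fun i _ => ha _)] at h1
    refine h1.trans_eq ?_
    rw [Finset.sum_range]
    exact Finset.sum_congr rfl fun i _ => hea _
  · intro h f g
    by_cases hg : Function.Injective g
    · have h2 : (X - C z) ^ m ∣ ∏ i, a (g i) := by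
        rw [X_sub_C_pow_dvd_prod_iff _ _ (fun i _ => ha _)]
        refine h.trans ((sum_range_le_sum_of_injective he (φ := fun i => (σ.symm (g i) : ℕ))
          (fun i j hij => hg (σ.symm.injective (Fin.val_injective hij)))
          (fun i => Fin.is_lt _)).trans_eq ?_)
        refine Finset.sum_congr rfl fun i _ => ?_
        rw [← hea, Equiv.apply_symm_apply]
      refine h2.trans ?_
      rw [det_apply]
      refine Finset.dvd_sum fun τ _ => ?_
      rw [Units.smul_def, zsmul_eq_mul]
      refine Dvd.dvd.mul_left (Finset.prod_dvd_prod_of_dvd _ _ fun i _ => ?_) _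
      rw [submatrix_apply, diagonal_apply]
      split_ifs with hfg
      · rw [hfg]
      · exact dvd_zero _
    · simp only [Function.Injective, not_forall] at hg
      obtain ⟨i, j, hij, hne⟩ := hg
      rw [det_zero_of_column_eq hne (fun t => by simp [hij])]
      exact dvd_zero _

/-- The orders of the determinantal divisors of a nonsingular polynomial matrix at a point are
the partial sums of a nondecreasing sequence. -/
theorem exists_minorsDvd_iff_le_sum {K : Type*} [Field K] {n : ℕ}
    (M : Matrix (Fin n) (Fin n) K[X]) (hM : M.det ≠ 0) (z : K) :
    ∃ e : ℕ → ℕ, (∀ i j, i ≤ j → j < n → e i ≤ e j) ∧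
      ∀ k ≤ n, ∀ m, MinorsDvd ((X - C z) ^ m) k M ↔ m ≤ ∑ i ∈ Finset.range k, e i := by
  obtain ⟨P, Q, a, hP, hQ, h⟩ := exists_isUnit_mul_eq_mul_diagonal M hM
  have ha : ∀ i, a i ≠ 0 := by
    have hdet : (M * Q).det ≠ 0 := by
      rw [det_mul]
      exact mul_ne_zero hM (((Matrix.isUnit_iff_isUnit_det Q).mp hQ).ne_zero)
    rw [h, det_mul, det_diagonal] at hdet
    intro i
    exact Finset.prod_ne_zero_iff.mp (right_ne_zero_of_mul hdet) i (Finset.mem_univ i)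
  let o : Fin n → ℕ := fun i => (a i).rootMultiplicity z
  let e : ℕ → ℕ := fun k => if hk : k < n then o (Tuple.sort o ⟨k, hk⟩) else 0
  have he : ∀ i j, i ≤ j → j < n → e i ≤ e j := by
    intro i j hij hj
    simp only [e, dif_pos hj, dif_pos (lt_of_le_of_lt hij hj)]
    exact Tuple.monotone_sort o (Fin.mk_le_mk.mpr hij)
  refine ⟨e, he, fun k hk m => ?_⟩
  rw [← minorsDvd_diagonal_iff hk a ha z (Tuple.sort o) e he (fun i => by simp [e, o]) m]
  obtain ⟨P, rfl⟩ := hP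
  obtain ⟨Q, rfl⟩ := hQ
  have h1 : M = P.val * diagonal a * (Q⁻¹).val := by
    rw [← h, Matrix.mul_assoc, Units.mul_inv, Matrix.mul_one]
  have h2 : diagonal a = (P⁻¹).val * (M * Q.val) := by
    rw [h, ← Matrix.mul_assoc, Units.inv_mul, Matrix.one_mul]
  constructor
  · intro H
    rw [h2]
    exact (H.mul_right _).mul_left _
  · intro H
    rw [h1]
    exact (H.mul_left _).mul_right _

end Smith

section PencilMat

variable {n : ℕ}

/-- The pencil `A + λB` as a polynomial matrix. -/
noncomputable def pencilMat {R : Type*} [CommRing R] (A B : Matrix (Fin n) (Fin n) R) :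
    Matrix (Fin n) (Fin n) R[X] :=
  A.map C + (X : R[X]) • B.map C

theorem pencilPoly_eq (A B : Matrix (Fin n) (Fin n) ℂ) :
    pencilPoly n A B = (pencilMat A B).det := rfl

theorem pencilMat_add {R : Type*} [CommRing R] (A B A' B' : Matrix (Fin n) (Fin n) R) :
    pencilMat (A + A') (B + B') = pencilMat A B + pencilMat A' B' := by
  ext1 i j
  simp [pencilMat]
  ring

theorem natCast_le_orderVan_iff (p : ℂ[X]) (z : ℂ) (m : ℕ) :
    (m : ℕ∞) ≤ orderVan p z ↔ (X - C z) ^ m ∣ p := by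
  unfold orderVan
  split_ifs with h
  · simp [h]
  · rw [Nat.cast_le, le_rootMultiplicity_iff h]

theorem natCast_le_minorOrder_iff (k : ℕ) (A B : Matrix (Fin n) (Fin n) ℂ) (z : ℂ) (m : ℕ) :
    (m : ℕ∞) ≤ minorOrder n k A B z ↔ MinorsDvd ((X - C z) ^ m) k (pencilMat A B) := by
  unfold minorOrder
  simp only [le_iInf_iff, natCast_le_orderVan_iff]
  constructor
  · intro h f g
    by_cases hf : Function.Injective f
    · by_cases hg : Function.Injective g
      · exact h ⟨f, hf⟩ ⟨g, hg⟩
      · simp only [Function.Injective, not_forall] at hg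
        obtain ⟨i, j, hij, hne⟩ := hg
        rw [det_zero_of_column_eq hne (fun t => by simp [hij])]
        exact dvd_zero _
    · simp only [Function.Injective, not_forall] at hf
      obtain ⟨i, j, hij, hne⟩ := hf
      rw [det_zero_of_row_eq hne (by ext t; simp [hij])]
      exact dvd_zero _
  · intro h f g
    exact h f g

theorem minorsDvd_card_iff {R : Type*} [CommRing R] (q : R) (M : Matrix (Fin n) (Fin n) R) :
    MinorsDvd q n M ↔ q ∣ M.det := by
  refine ⟨fun h => h id id, fun h f g => ?_⟩
  have e : M.submatrix f g = (1 : Matrix (Fin n) (Fin n) R).submatrix f id * M *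
      (1 : Matrix (Fin n) (Fin n) R).submatrix id g := by
    ext i j
    simp [Matrix.mul_apply, Matrix.one_apply]
  rw [e, det_mul, det_mul]
  exact Dvd.dvd.mul_right (Dvd.dvd.mul_left h _) _

theorem minorOrder_zero (A B : Matrix (Fin n) (Fin n) ℂ) (z : ℂ) :
    minorOrder n 0 A B z = 0 := by
  by_contra h
  have h1 : ((1 : ℕ) : ℕ∞) ≤ minorOrder n 0 A B z := by
    rw [Nat.cast_one]
    exact Order.one_le_iff_pos.mpr (pos_iff_ne_zero.mpr h)
  rw [natCast_le_minorOrder_iff] at h1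
  have h2 := h1 Fin.elim0 Fin.elim0
  rw [det_isEmpty, pow_one] at h2
  exact not_isUnit_X_sub_C z (isUnit_of_dvd_one h2)

theorem pencilPoly_natDegree_le (A B : Matrix (Fin n) (Fin n) ℂ) :
    (pencilPoly n A B).natDegree ≤ n := by
  have := natDegree_det_X_add_C_le B A
  rw [Fintype.card_fin] at this
  rwa [pencilPoly, add_comm]

theorem pencilPoly_swap (A B : Matrix (Fin n) (Fin n) ℂ) :
    pencilPoly n B A = reflect n (pencilPoly n A B) := by
  refine eq_of_infinite_eval_eq _ _ (Set.Infinite.mono (s := {0}ᶜ) ?_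
    (Set.finite_singleton (0 : ℂ)).infinite_compl)
  intro z hz
  have hz0 : z ≠ 0 := hz
  let _ : Invertible z⁻¹ := invertibleOfNonzero (inv_ne_zero hz0)
  have h := eval₂_reflect_mul_pow (RingHom.id ℂ) z⁻¹ n (pencilPoly n A B)
    (pencilPoly_natDegree_le A B)
  have hinv : ⅟(z⁻¹) = z := by rw [invOf_eq_inv, inv_inv]
  rw [hinv] at h
  simp only [eval₂_id] at h
  have hev : ∀ (A B : Matrix (Fin n) (Fin n) ℂ) (w : ℂ),
      (pencilPoly n A B).eval w = (A + w • B).det := by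
    intro A B w
    rw [pencilPoly, ← coe_evalRingHom, RingHom.map_det]
    congr 1
    ext i j
    simp
    ring
  have h2 : (reflect n (pencilPoly n A B)).eval z = z ^ n * (pencilPoly n A B).eval z⁻¹ := by
    rw [← h, mul_comm, mul_assoc, ← mul_pow, inv_mul_cancel₀ hz0, one_pow, mul_one]
  change (pencilPoly n B A).eval z = _
  rw [h2, hev, hev]
  have h3 : B + z • A = z • (A + z⁻¹ • B) := by
    rw [smul_add, smul_smul, mul_inv_cancel₀ hz0, one_smul, add_comm]
  rw [h3, det_smul, Fintype.card_fin]

theorem PencilRegular.swap {A B : Matrix (Fin n) (Fin n) ℂ} (h : PencilRegular n A B) :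
    PencilRegular n B A := by
  unfold PencilRegular at *
  rw [pencilPoly_swap]
  simpa using h

/-- `m_k` at a finite or infinite point. -/
noncomputable def minorOrderAt (n k : ℕ) (A B : Matrix (Fin n) (Fin n) ℂ) : Option ℂ → ℕ∞
  | some z => minorOrder n k A B z
  | none => minorOrder n k B A 0

theorem pmAt_eq (A B : Matrix (Fin n) (Fin n) ℂ) (μ : Option ℂ) :
    pmAt n A B μ = ((Multiset.range n).map fun k =>
      (minorOrderAt n (k + 1) A B μ - minorOrderAt n k A B μ).toNat).filter (fun m => 0 < m) := by
  cases μ <;> rfl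

theorem minorOrderAt_zero (A B : Matrix (Fin n) (Fin n) ℂ) (μ : Option ℂ) :
    minorOrderAt n 0 A B μ = 0 := by
  cases μ <;> exact minorOrder_zero _ _ _

theorem minorOrder_card (A B : Matrix (Fin n) (Fin n) ℂ) (z : ℂ) :
    minorOrder n n A B z = orderVan (pencilPoly n A B) z := by
  refine ENat.eq_of_forall_natCast_le_iff fun m => ?_
  rw [natCast_le_minorOrder_iff, natCast_le_orderVan_iff, minorsDvd_card_iff, pencilPoly_eq]

theorem exists_minorOrderAt_eq_sum {A B : Matrix (Fin n) (Fin n) ℂ} (h : PencilRegular n A B)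
    (μ : Option ℂ) :
    ∃ e : ℕ → ℕ, (∀ i j, i ≤ j → j < n → e i ≤ e j) ∧
      ∀ k ≤ n, minorOrderAt n k A B μ = ((∑ i ∈ Finset.range k, e i : ℕ) : ℕ∞) := by
  suffices H : ∀ (A B : Matrix (Fin n) (Fin n) ℂ) (z : ℂ), PencilRegular n A B →
      ∃ e : ℕ → ℕ, (∀ i j, i ≤ j → j < n → e i ≤ e j) ∧
        ∀ k ≤ n, minorOrder n k A B z = ((∑ i ∈ Finset.range k, e i : ℕ) : ℕ∞) by
    cases μ with
    | none => exact H B A 0 h.swap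
    | some z => exact H A B z h
  intro A B z h
  obtain ⟨e, he, hk⟩ := exists_minorsDvd_iff_le_sum (pencilMat A B) h z
  refine ⟨e, he, fun k hkn => ?_⟩
  refine ENat.eq_of_forall_natCast_le_iff fun m => ?_
  rw [natCast_le_minorOrder_iff, hk k hkn, Nat.cast_le]

end PencilMat

section Multisets

theorem filter_pos_map_range {m g : ℕ} {f : ℕ → ℕ} (hg : g ≤ m)
    (hf : ∀ j < m, 0 < f j ↔ j < g) :
    ((Multiset.range m).map f).filter (fun t => 0 < t) = (Multiset.range g).map f := by
  rw [Multiset.filter_map]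
  congr 1
  refine (Multiset.Nodup.ext ((Multiset.nodup_range m).filter _) (Multiset.nodup_range g)).mpr
    fun j => ?_
  simp only [Multiset.mem_filter, Multiset.mem_range, Function.comp_apply]
  exact ⟨fun h => (hf j h.1).mp h.2, fun h => ⟨by lia, (hf j (by lia)).mpr h⟩⟩

theorem map_range_reflect (m : ℕ) (f : ℕ → ℕ) :
    (Multiset.range m).map (fun j => f (m - 1 - j)) = (Multiset.range m).map f := by
  have h : (Multiset.range m).map (fun j => m - 1 - j) = Multiset.range m := by
    refine (Multiset.Nodup.ext ?_ (Multiset.nodup_range m)).mpr fun j => ?_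
    · refine (Multiset.nodup_range m).map_on fun x hx y hy hxy => ?_
      rw [Multiset.mem_range] at hx hy
      lia
    · simp only [Multiset.mem_map, Multiset.mem_range]
      exact ⟨by rintro ⟨a, ha, rfl⟩; lia, fun hj => ⟨m - 1 - j, by lia, by lia⟩⟩
  conv_rhs => rw [← h, Multiset.map_map]
  rfl

theorem eq_of_filter_pos_eq {s t : Multiset ℕ} (hc : Multiset.card s = Multiset.card t)
    (h : s.filter (fun m => 0 < m) = t.filter (fun m => 0 < m)) : s = t := by
  have key : ∀ u : Multiset ℕ, u = u.filter (fun m => 0 < m) +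
      Multiset.replicate (Multiset.card u - Multiset.card (u.filter (fun m => 0 < m))) 0 := by
    intro u
    conv_lhs => rw [← Multiset.filter_add_not (fun m => 0 < m) u]
    congr 1
    have hu : ∀ b ∈ u.filter (fun m => ¬ 0 < m), b = 0 := by
      intro b hb
      have := (Multiset.mem_filter.mp hb).2
      lia
    rw [Multiset.eq_replicate_card.mpr hu]
    congr 1
    have := congrArg Multiset.card (Multiset.filter_add_not (fun m => 0 < m) u)
    rw [Multiset.card_add] at this
    lia
  rw [key s, key t, h, hc]

theorem filter_pos_map_range_sub {n r g : ℕ} {e nn : ℕ → ℕ}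
    (he : ∀ i j, i ≤ j → j < n → e i ≤ e j) (hnn : ∀ j k : ℕ, j ≤ k → nn k ≤ nn j)
    (hpos : ∀ j : ℕ, 0 < nn j ↔ j < g)
    (h : ((Multiset.range n).map e).filter (fun m => 0 < m) = (Multiset.range g).map nn) :
    ((Multiset.range (n - r)).map e).filter (fun m => 0 < m)
      = (Multiset.range (g - r)).map fun j => nn (r + j) := by
  have hgn : g ≤ n := by
    have h1 := congrArg Multiset.card h
    have h2 := Multiset.card_le_card (Multiset.filter_le (fun m => 0 < m) ((Multiset.range n).map e))
    simp only [Multiset.card_map, Multiset.card_range] at h1 h2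
    lia
  have hmap : (Multiset.range n).map nn = (Multiset.range n).map fun j => e (n - 1 - j) := by
    rw [map_range_reflect]
    refine eq_of_filter_pos_eq (by simp) ?_
    rw [h, filter_pos_map_range hgn fun j _ => hpos j]
  have hlist : (List.range n).map nn = (List.range n).map fun j => e (n - 1 - j) := by
    refine List.Perm.eq_of_pairwise (le := fun a b => b ≤ a) (fun a b _ _ h1 h2 => le_antisymm h2 h1)
      ?_ ?_ (Multiset.coe_eq_coe.mp hmap)
    · rw [List.pairwise_map]
      refine List.pairwise_lt_range.imp fun hab => hnn _ _ hab.le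
    · rw [List.pairwise_map]
      refine (List.pairwise_lt_range (n := n)).imp_of_mem fun ha hb hab => he _ _ (by lia) ?_
      rw [List.mem_range] at ha
      lia
  have hval : ∀ j < n, nn j = e (n - 1 - j) := fun j hj =>
    List.map_inj_left.mp hlist j (List.mem_range.mpr hj)
  rw [← map_range_reflect, ← filter_pos_map_range (m := n - r) (g := g - r)
    (f := fun j => nn (r + j)) (by lia) (fun j _ => by rw [hpos]; lia)]
  congr 1
  refine Multiset.map_congr rfl fun j hj => ?_
  rw [Multiset.mem_range] at hj
  rw [hval _ (by lia)]
  congr 1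
  lia

end Multisets

section RankBound

variable {n : ℕ}

/-- The pencil `E + λF` is a sum of `r` pencils, each of which is a dyad with one constant
factor. -/
def IsDyadSum (r : ℕ) (E F : Matrix (Fin n) (Fin n) ℂ) : Prop :=
  ∃ (σ : Type) (_ : Fintype σ) (x x' y y' : σ → Fin n → ℂ), Fintype.card σ = r ∧
    (∀ c, x c = x' c ∨ y c = y' c) ∧ E = ∑ c, vecMulVec (x c) (y c) ∧
    F = ∑ c, vecMulVec (x' c) (y' c)

theorem IsDyadSum.swap {r : ℕ} {E F : Matrix (Fin n) (Fin n) ℂ} (h : IsDyadSum r E F) :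
    IsDyadSum r F E := by
  obtain ⟨σ, _, x, x', y, y', hc, hxy, hE, hF⟩ := h
  exact ⟨σ, _, x', x, y', y, hc, fun c => (hxy c).imp Eq.symm Eq.symm, hF, hE⟩

theorem pencilMat_sum {σ : Type*} [Fintype σ] (E F : σ → Matrix (Fin n) (Fin n) ℂ) :
    pencilMat (∑ c, E c) (∑ c, F c) = ∑ c, pencilMat (E c) (F c) := by
  ext1 i j
  simp [pencilMat, Matrix.sum_apply, Finset.sum_add_distrib, Finset.mul_sum]

theorem IsDyadSum.exists_pencilMat_eq {r : ℕ} {E F : Matrix (Fin n) (Fin n) ℂ}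
    (h : IsDyadSum r E F) :
    ∃ (σ : Type) (_ : Fintype σ) (x y : σ → Fin n → ℂ[X]), Fintype.card σ = r ∧
      pencilMat E F = ∑ c, vecMulVec (x c) (y c) := by
  obtain ⟨σ, _, x, x', y, y', hc, hxy, hE, hF⟩ := h
  have key : ∀ c, ∃ p : (Fin n → ℂ[X]) × (Fin n → ℂ[X]),
      pencilMat (vecMulVec (x c) (y c)) (vecMulVec (x' c) (y' c)) = vecMulVec p.1 p.2 := by
    intro c
    rcases hxy c with hx | hy
    · refine ⟨⟨fun i => C (x c i), fun j => C (y c j) + X * C (y' c j)⟩, ?_⟩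
      ext1 i j
      simp [pencilMat, vecMulVec_apply, ← hx]
      ring
    · refine ⟨⟨fun i => C (x c i) + X * C (x' c i), fun j => C (y c j)⟩, ?_⟩
      ext1 i j
      simp [pencilMat, vecMulVec_apply, ← hy]
      ring
  choose p hp using key
  refine ⟨σ, _, fun c => (p c).1, fun c => (p c).2, hc, ?_⟩
  rw [hE, hF, pencilMat_sum]
  exact Finset.sum_congr rfl fun c _ => hp c

theorem minorOrder_sub_le {r : ℕ} {E F : Matrix (Fin n) (Fin n) ℂ} (h : IsDyadSum r E F)
    (A B : Matrix (Fin n) (Fin n) ℂ) (k : ℕ) (z : ℂ) :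
    minorOrder n (k - r) A B z ≤ minorOrder n k (A + E) (B + F) z := by
  rcases le_or_gt r k with hk | hk
  · obtain ⟨σ, _, x, y, hc, hE⟩ := h.exists_pencilMat_eq
    refine ENat.forall_natCast_le_iff_le.mp fun m hm => ?_
    rw [natCast_le_minorOrder_iff] at hm ⊢
    have := hm.add_sum_vecMulVec Finset.univ x y
    rwa [Finset.card_univ, hc, ← hE, ← pencilMat_add, Nat.sub_add_cancel hk] at this
  · rw [Nat.sub_eq_zero_of_le hk.le, minorOrder_zero]
    exact zero_le

theorem minorOrderAt_sub_le {r : ℕ} {E F : Matrix (Fin n) (Fin n) ℂ} (h : IsDyadSum r E F)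
    (A B : Matrix (Fin n) (Fin n) ℂ) (k : ℕ) (μ : Option ℂ) :
    minorOrderAt n (k - r) A B μ ≤ minorOrderAt n k (A + E) (B + F) μ := by
  cases μ with
  | none => exact minorOrder_sub_le h.swap B A k 0
  | some z => exact minorOrder_sub_le h A B k z

theorem pmAt_eq_of_minorOrderAt_eq {A B A' B' : Matrix (Fin n) (Fin n) ℂ}
    (hreg : PencilRegular n A B) (μ : Option ℂ) (r g : ℕ) (nn : ℕ → ℕ)
    (h : ∀ k ≤ n, minorOrderAt n k A' B' μ = minorOrderAt n (k - r) A B μ)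
    (hnn : ∀ j k : ℕ, j ≤ k → nn k ≤ nn j) (hpos : ∀ j : ℕ, 0 < nn j ↔ j < g)
    (hpm : pmAt n A B μ = (Multiset.range g).map nn) :
    pmAt n A' B' μ = (Multiset.range (g - r)).map fun j => nn (r + j) := by
  obtain ⟨e, he, hsum⟩ := exists_minorOrderAt_eq_sum hreg μ
  have hinc : ∀ k < n, (minorOrderAt n (k + 1) A B μ - minorOrderAt n k A B μ).toNat = e k := by
    intro k hk
    rw [hsum _ hk, hsum _ hk.le, ← ENat.natCast_sub, ENat.toNat_natCast, Finset.sum_range_succ]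
    lia
  have hold : ((Multiset.range n).map e).filter (fun m => 0 < m) = (Multiset.range g).map nn := by
    rw [← hpm, pmAt_eq]
    congr 1
    exact Multiset.map_congr rfl fun k hk => (hinc k (Multiset.mem_range.mp hk)).symm
  rw [← filter_pos_map_range_sub he hnn hpos hold, pmAt_eq]
  have hnew : ∀ k < n, (minorOrderAt n (k + 1) A' B' μ - minorOrderAt n k A' B' μ).toNat
      = if r ≤ k then e (k - r) else 0 := by
    intro k hk
    rw [h _ hk, h _ hk.le]
    split_ifs with hrk
    · rw [← hinc (k - r) (by lia), show k.succ - r = k - r + 1 by lia]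
    · rw [Nat.sub_eq_zero_of_le (by lia), Nat.sub_eq_zero_of_le (by lia)]
      simp
  rw [Multiset.map_congr rfl fun k hk => hnew k (Multiset.mem_range.mp hk)]
  rcases le_or_gt r n with hrn | hrn
  · obtain ⟨d, rfl⟩ := Nat.exists_eq_add_of_le hrn
    rw [Multiset.range_add, Multiset.map_add, Multiset.filter_add, Nat.add_sub_cancel_left,
      Multiset.filter_eq_nil.mpr, zero_add, Multiset.map_map]
    · simp
    · intro a ha
      obtain ⟨k, hk, rfl⟩ := Multiset.mem_map.mp ha
      simp [Multiset.mem_range.mp hk]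
  · rw [Nat.sub_eq_zero_of_le hrn.le, Multiset.range_zero, Multiset.map_zero, Multiset.filter_zero,
      Multiset.filter_eq_nil]
    intro a ha
    obtain ⟨k, hk, rfl⟩ := Multiset.mem_map.mp ha
    have := Multiset.mem_range.mp hk
    simp
    lia

end RankBound

section Families

variable {n : ℕ} {ι : Type*}

theorem pencilMat_map {R S : Type*} [CommRing R] [CommRing S] (φ : R →+* S)
    (A B : Matrix (Fin n) (Fin n) R) :
    (pencilMat A B).map (mapRingHom φ) = pencilMat (A.map φ) (B.map φ) := by
  ext1 i j
  simp [pencilMat]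

theorem minorOrder_le_iff_exists_coeff (k c : ℕ) (A B : Matrix (Fin n) (Fin n) ℂ) (z : ℂ) :
    minorOrder n k A B z ≤ c ↔ ∃ (f g : Fin k → Fin n) (j : ℕ), j ≤ c ∧
      (taylor z ((pencilMat A B).submatrix f g).det).coeff j ≠ 0 := by
  have h1 : minorOrder n k A B z ≤ c ↔ ¬ ((c + 1 : ℕ) : ℕ∞) ≤ minorOrder n k A B z := by
    rw [not_le, Nat.cast_add, Nat.cast_one, ENat.lt_add_one_iff (ENat.natCast_ne_top c)]
  rw [h1, natCast_le_minorOrder_iff]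
  have h2 : ∀ p : ℂ[X], (X - C z) ^ (c + 1) ∣ p ↔ ∀ j < c + 1, (taylor z p).coeff j = 0 := by
    intro p
    have e : taylorEquiv z ((X - C z) ^ (c + 1)) = X ^ (c + 1) := by
      change taylor z ((X - C z) ^ (c + 1)) = _
      simp
    rw [← X_pow_dvd_iff, ← map_dvd_iff (taylorEquiv z), e]
    rfl
  simp only [MinorsDvd, not_forall, h2, Nat.lt_succ_iff, exists_prop]

theorem exists_mvPolynomial_minorOrder_le (𝓐 𝓑 : Matrix (Fin n) (Fin n) (MvPolynomial ι ℂ))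
    (k c : ℕ) (z : ℂ) (Y₀ : ι → ℂ)
    (h : minorOrder n k (𝓐.map (MvPolynomial.eval Y₀)) (𝓑.map (MvPolynomial.eval Y₀)) z ≤ c) :
    ∃ P : MvPolynomial ι ℂ, MvPolynomial.eval Y₀ P ≠ 0 ∧ ∀ Y, MvPolynomial.eval Y P ≠ 0 →
      minorOrder n k (𝓐.map (MvPolynomial.eval Y)) (𝓑.map (MvPolynomial.eval Y)) z ≤ c := by
  obtain ⟨f, g, j, hj, hne⟩ := (minorOrder_le_iff_exists_coeff _ _ _ _ _).mp h
  have key : ∀ Y : ι → ℂ, MvPolynomial.eval Y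
      ((taylor (MvPolynomial.C z) ((pencilMat 𝓐 𝓑).submatrix f g).det).coeff j)
      = (taylor z ((pencilMat (𝓐.map (MvPolynomial.eval Y))
          (𝓑.map (MvPolynomial.eval Y))).submatrix f g).det).coeff j := by
    intro Y
    rw [← pencilMat_map, Matrix.submatrix_map, ← RingHom.mapMatrix_apply, ← RingHom.map_det,
      coe_mapRingHom, ← coeff_map, map_taylor, MvPolynomial.eval_C]
  refine ⟨_, by rw [key]; exact hne, fun Y hY => ?_⟩
  rw [key] at hY
  exact (minorOrder_le_iff_exists_coeff _ _ _ _ _).mpr ⟨f, g, j, hj, hY⟩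

theorem exists_mvPolynomial_minorOrderAt_le
    (𝓐 𝓑 : Matrix (Fin n) (Fin n) (MvPolynomial ι ℂ)) (k : ℕ) {c : ℕ∞} (hc : c ≠ ⊤)
    (μ : Option ℂ) (Y₀ : ι → ℂ)
    (h : minorOrderAt n k (𝓐.map (MvPolynomial.eval Y₀)) (𝓑.map (MvPolynomial.eval Y₀)) μ ≤ c) :
    ∃ P : MvPolynomial ι ℂ, MvPolynomial.eval Y₀ P ≠ 0 ∧ ∀ Y, MvPolynomial.eval Y P ≠ 0 →
      minorOrderAt n k (𝓐.map (MvPolynomial.eval Y)) (𝓑.map (MvPolynomial.eval Y)) μ ≤ c := by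
  lift c to ℕ using hc
  cases μ with
  | none => exact exists_mvPolynomial_minorOrder_le 𝓑 𝓐 k c 0 Y₀ h
  | some z => exact exists_mvPolynomial_minorOrder_le 𝓐 𝓑 k c z Y₀ h

end Families

section RankOne

variable {n : ℕ}

/-- A dyad perturbation whose scalar factor does not vanish at `z` can lower `m_{k+1}(z)`
to `m_k(z)`. -/
theorem exists_vecMulVec_minorOrder_le (A B : Matrix (Fin n) (Fin n) ℂ) {z α β : ℂ}
    (hz : α + β * z ≠ 0) {k c : ℕ} (hk : k < n) (h : minorOrder n k A B z ≤ c) :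
    ∃ x y : Fin n → ℂ,
      minorOrder n (k + 1) (A + α • vecMulVec x y) (B + β • vecMulVec x y) z ≤ c := by
  have hle : ∀ (m : ℕ∞), m ≤ c ↔ ¬ ((c + 1 : ℕ) : ℕ∞) ≤ m := by
    intro m
    rw [not_le, Nat.cast_add, Nat.cast_one, ENat.lt_add_one_iff (ENat.natCast_ne_top c)]
  by_contra hcon
  simp only [not_exists, hle, not_not, natCast_le_minorOrder_iff] at hcon h
  refine h fun f g => ?_
  have hinj : ∀ φ : Fin k → Fin n, ∃ a, a ∉ Set.range φ := by
    intro φ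
    by_contra! H
    have := Fintype.card_le_of_surjective φ H
    simp only [Fintype.card_fin] at this
    lia
  obtain ⟨a, ha⟩ := hinj f
  obtain ⟨b, hb⟩ := hinj g
  have hmat : ∀ t : ℂ, (pencilMat (A + α • vecMulVec (t • Pi.single a 1) (Pi.single b 1))
        (B + β • vecMulVec (t • Pi.single a 1) (Pi.single b 1))).submatrix
          (Fin.cons a f : Fin (k + 1) → Fin n) (Fin.cons b g : Fin (k + 1) → Fin n)
      = (pencilMat A B).submatrix (Fin.cons a f : Fin (k + 1) → Fin n) (Fin.cons b g)
        + vecMulVec ((C t * (C α + C β * X)) • (Pi.single 0 1 : Fin (k + 1) → ℂ[X]))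
          (Pi.single 0 1) := by
    intro t
    have hf : ∀ i, f i ≠ a := fun i hi => ha ⟨i, hi⟩
    have hg : ∀ i, g i ≠ b := fun i hi => hb ⟨i, hi⟩
    ext1 i j
    refine Fin.cases ?_ (fun i => ?_) i <;> refine Fin.cases ?_ (fun j => ?_) j
    · simp [pencilMat, vecMulVec_apply]
      ring
    · simp [pencilMat, vecMulVec_apply, hg]
    · simp [pencilMat, vecMulVec_apply, hf]
    · simp [pencilMat, vecMulVec_apply, hf]
  have hdet : ∀ t : ℂ, (X - C z) ^ (c + 1) ∣
      ((pencilMat A B).submatrix (Fin.cons a f : Fin (k + 1) → Fin n) (Fin.cons b g)).det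
        + C t * (C α + C β * X) * ((pencilMat A B).submatrix f g).det := by
    intro t
    have h1 := hcon (t • Pi.single a 1) (Pi.single b 1) (Fin.cons a f) (Fin.cons b g)
    rw [hmat, det_add_vecMulVec_eq_add_sum, Finset.sum_eq_single 0] at h1
    · rw [det_succ_row_zero (updateRow _ _ _), Finset.sum_eq_single 0] at h1
      · have e : ((((pencilMat A B).submatrix (Fin.cons a f : Fin (k + 1) → Fin n)
            (Fin.cons b g)).updateRow 0 (Pi.single 0 1)).submatrix Fin.succ (Fin.succAbove 0))
            = (pencilMat A B).submatrix f g := by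
          ext1 i j
          simp [Matrix.updateRow_apply]
        rw [e] at h1
        simpa using h1
      · intro j _ hj
        simp [hj]
      · simp
    · intro i _ hi
      simp [hi]
    · simp
  have h1 := dvd_sub (hdet 1) (hdet 0)
  simp only [C_1, C_0, one_mul, zero_mul, add_zero, add_sub_cancel_left] at h1
  refine IsCoprime.dvd_of_dvd_mul_left ?_ h1
  refine IsCoprime.pow_left ?_
  rw [(irreducible_X_sub_C z).coprime_iff_not_dvd, dvd_iff_isRoot]
  simpa using hz

end RankOne

section CriticalValues

/-- For all but finitely many `t`, every multiple root of `p + t h` is a root of `p`. -/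
theorem exists_finset_eval_eq_zero_of_multiple_root (p h : ℂ[X]) :
    ∃ T : Finset ℂ, ∀ t ∉ T, p + C t * h ≠ 0 →
      ∀ z, 2 ≤ (p + C t * h).rootMultiplicity z → p.eval z = 0 := by
  classical
  let w := derivative p * h - p * derivative h
  refine ⟨w.roots.toFinset.image fun z => -(p.eval z / h.eval z), fun t ht hne z hz => ?_⟩
  by_contra hp
  have hroot : (p + C t * h).eval z = 0 := (rootMultiplicity_pos hne).mp (by lia)
  have hder : (derivative (p + C t * h)).eval z = 0 := by
    have := (one_lt_rootMultiplicity_iff_isRoot hne).mp (by lia : 1 < (p + C t * h).rootMultiplicity z)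
    exact this.2
  simp only [eval_add, eval_mul, eval_C, derivative_add, derivative_mul, derivative_C, zero_mul,
    zero_add] at hroot hder
  have hh : h.eval z ≠ 0 := by
    intro hh
    rw [hh, mul_zero, add_zero] at hroot
    exact hp hroot
  have ht' : t = -(p.eval z / h.eval z) := by
    field_simp
    linear_combination hroot
  have hw : w.eval z = 0 := by
    simp only [w, eval_sub, eval_mul]
    linear_combination h.eval z * hder - (derivative h).eval z * hroot
  have hw0 : w = 0 := by
    by_contra hw0
    refine ht (Finset.mem_image.mpr ⟨z, ?_, ht'.symm⟩)
    rw [Multiset.mem_toFinset, mem_roots hw0]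
    exact hw
  set q := p + C t * h with hq
  have hrel : derivative q * p = q * derivative p := by
    simp only [hq, derivative_add, derivative_mul, derivative_C, zero_mul, zero_add]
    simp only [w] at hw0
    linear_combination (-C t) * hw0
  have hcop : IsCoprime ((X - C z) ^ q.rootMultiplicity z) p := by
    refine IsCoprime.pow_left ?_
    rw [(irreducible_X_sub_C z).coprime_iff_not_dvd, dvd_iff_isRoot]
    exact hp
  have hdvd : (X - C z) ^ q.rootMultiplicity z ∣ derivative q :=
    hcop.dvd_of_dvd_mul_right (hrel ▸ Dvd.dvd.mul_right (pow_rootMultiplicity_dvd q z) _)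
  have hd0 : derivative q ≠ 0 := by
    intro h0
    have hdeg := derivative_eq_zero.mp h0
    rw [eq_C_of_natDegree_eq_zero hdeg, rootMultiplicity_C] at hz
    lia
  have h1 := (le_rootMultiplicity_iff hd0).mpr hdvd
  rw [derivative_rootMultiplicity_of_root ((rootMultiplicity_pos hne).mp (by lia))] at h1
  lia

end CriticalValues

section RankOneStep

variable {n : ℕ}

theorem exists_mvPolynomial_forall_mem {ι κ : Type*} (s : Finset κ) (Q : κ → (ι → ℂ) → Prop)
    (h : ∀ i ∈ s, ∃ P : MvPolynomial ι ℂ, P ≠ 0 ∧ ∀ Y, MvPolynomial.eval Y P ≠ 0 → Q i Y) :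
    ∃ P : MvPolynomial ι ℂ, P ≠ 0 ∧ ∀ Y, MvPolynomial.eval Y P ≠ 0 → ∀ i ∈ s, Q i Y := by
  classical
  choose! P hP0 hP using h
  refine ⟨∏ i ∈ s, P i, Finset.prod_ne_zero_iff.mpr hP0, fun Y hY i hi => hP i hi Y ?_⟩
  rw [map_prod, Finset.prod_ne_zero_iff] at hY
  exact hY i hi

theorem exists_eval_ne_zero {ι : Type*} {P : MvPolynomial ι ℂ} (hP : P ≠ 0) :
    ∃ Y, MvPolynomial.eval Y P ≠ 0 := by
  by_contra! h
  exact hP (MvPolynomial.funext fun Y => by rw [h Y, map_zero])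

theorem eval_aeval_mvPolynomial {ι : Type*} (f : ι → ℂ[X]) (P : MvPolynomial ι ℂ) (t : ℂ) :
    (MvPolynomial.aeval f P).eval t = MvPolynomial.eval (fun i => (f i).eval t) P := by
  induction P using MvPolynomial.induction_on with
  | C a => simp
  | add p q hp hq => simp [hp, hq]
  | mul_X p i hp => simp [hp]

theorem minorOrderAt_ne_top {A B : Matrix (Fin n) (Fin n) ℂ} (h : PencilRegular n A B)
    (μ : Option ℂ) {k : ℕ} (hk : k ≤ n) : minorOrderAt n k A B μ ≠ ⊤ := by
  obtain ⟨e, -, he⟩ := exists_minorOrderAt_eq_sum h μ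
  rw [he k hk]
  exact ENat.natCast_ne_top _

theorem minorOrderAt_mono {A B : Matrix (Fin n) (Fin n) ℂ} (h : PencilRegular n A B)
    (μ : Option ℂ) {j k : ℕ} (hjk : j ≤ k) (hk : k ≤ n) :
    minorOrderAt n j A B μ ≤ minorOrderAt n k A B μ := by
  obtain ⟨e, -, he⟩ := exists_minorOrderAt_eq_sum h μ
  rw [he k hk, he j (hjk.trans hk)]
  exact_mod_cast Finset.sum_le_sum_of_subset (Finset.range_mono hjk)

theorem minorOrderAt_card_some {A B : Matrix (Fin n) (Fin n) ℂ} (h : PencilRegular n A B)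
    (z : ℂ) : minorOrderAt n n A B (some z) = ((pencilPoly n A B).rootMultiplicity z : ℕ∞) := by
  rw [minorOrderAt, minorOrder_card, orderVan, if_neg h]

theorem minorOrderAt_card_none {A B : Matrix (Fin n) (Fin n) ℂ} (h : PencilRegular n A B) :
    minorOrderAt n n A B none = ((pencilPoly n B A).rootMultiplicity 0 : ℕ∞) :=
  minorOrderAt_card_some h.swap 0

theorem pencilRegular_of_minorOrderAt_none_ne_top {A B : Matrix (Fin n) (Fin n) ℂ}
    (h : minorOrderAt n n A B none ≠ ⊤) : PencilRegular n A B := by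
  refine PencilRegular.swap fun h0 => h ?_
  rw [minorOrderAt, minorOrder_card, orderVan, if_pos h0]

theorem isDyadSum_one_smul_vecMulVec (α β : ℂ) (x y : Fin n → ℂ) :
    IsDyadSum 1 (α • vecMulVec x y) (β • vecMulVec x y) :=
  ⟨Unit, inferInstance, fun _ => α • x, fun _ => β • x, fun _ => y, fun _ => y, by simp,
    fun _ => Or.inr rfl, by simp [smul_vecMulVec], by simp [smul_vecMulVec]⟩

theorem exists_pencilPoly_add_smul_vecMulVec (A B : Matrix (Fin n) (Fin n) ℂ) (α β : ℂ)
    (x y : Fin n → ℂ) : ∃ h : ℂ[X], ∀ t : ℂ,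
      pencilPoly n (A + α • vecMulVec (t • x) y) (B + β • vecMulVec (t • x) y)
        = pencilPoly n A B + C t * h := by
  refine ⟨∑ i, (C α + C β * X) * C (x i) *
    ((pencilMat A B).updateRow i fun j => C (y j)).det, fun t => ?_⟩
  have e : pencilMat (A + α • vecMulVec (t • x) y) (B + β • vecMulVec (t • x) y)
      = pencilMat A B + vecMulVec (fun i => C t * ((C α + C β * X) * C (x i)))
        (fun j => C (y j)) := by
    ext1 i j
    simp [pencilMat, vecMulVec_apply]
    ring
  rw [pencilPoly_eq, e, det_add_vecMulVec_eq_add_sum, pencilPoly_eq, Finset.mul_sum]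
  simp only [mul_assoc]

theorem exists_mvPolynomial_vecMulVec_minorOrderAt_le {A B : Matrix (Fin n) (Fin n) ℂ}
    (hreg : PencilRegular n A B) {α : ℂ} {μ : Option ℂ} (hα : ∀ z, μ = some z → α + z ≠ 0)
    {k : ℕ} (hk : k < n) :
    ∃ P : MvPolynomial (Fin n ⊕ Fin n) ℂ, P ≠ 0 ∧ ∀ Y, MvPolynomial.eval Y P ≠ 0 →
      minorOrderAt n (k + 1) (A + α • vecMulVec (Y ∘ Sum.inl) (Y ∘ Sum.inr))
        (B + (1 : ℂ) • vecMulVec (Y ∘ Sum.inl) (Y ∘ Sum.inr)) μ ≤ minorOrderAt n k A B μ := by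
  have hw : ∃ x y : Fin n → ℂ, minorOrderAt n (k + 1) (A + α • vecMulVec x y)
      (B + (1 : ℂ) • vecMulVec x y) μ ≤ minorOrderAt n k A B μ := by
    obtain ⟨c, hc⟩ := ENat.ne_top_iff_exists.mp (minorOrderAt_ne_top hreg μ hk.le)
    rw [← hc]
    cases μ with
    | none => exact exists_vecMulVec_minorOrder_le B A (by simp) hk hc.ge
    | some z => exact exists_vecMulVec_minorOrder_le A B (by simpa using hα z rfl) hk hc.ge
  obtain ⟨x, y, hxy⟩ := hw
  let V : Matrix (Fin n) (Fin n) (MvPolynomial (Fin n ⊕ Fin n) ℂ) :=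
    vecMulVec (fun i => MvPolynomial.X (Sum.inl i)) (fun j => MvPolynomial.X (Sum.inr j))
  let 𝓕 (M : Matrix (Fin n) (Fin n) ℂ) (c : ℂ) :
      Matrix (Fin n) (Fin n) (MvPolynomial (Fin n ⊕ Fin n) ℂ) :=
    M.map MvPolynomial.C + (MvPolynomial.C c : MvPolynomial (Fin n ⊕ Fin n) ℂ) • V
  have hev : ∀ (M : Matrix (Fin n) (Fin n) ℂ) (c : ℂ) (Y : Fin n ⊕ Fin n → ℂ),
      (𝓕 M c).map (MvPolynomial.eval Y)
        = M + c • vecMulVec (Y ∘ Sum.inl) (Y ∘ Sum.inr) := by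
    intro M c Y
    ext1 i j
    simp [𝓕, V, vecMulVec_apply]
  obtain ⟨P, hP, h⟩ := exists_mvPolynomial_minorOrderAt_le (𝓕 A α) (𝓕 B 1) (k + 1)
    (minorOrderAt_ne_top hreg μ hk.le) μ (Sum.elim x y) (by
      rw [hev, hev, Sum.elim_comp_inl, Sum.elim_comp_inr]
      exact hxy)
  refine ⟨P, fun h0 => hP (by rw [h0, map_zero]), fun Y hY => ?_⟩
  have := h Y hY
  rwa [hev, hev] at this

/-- The rank-one case over `ℂ`, without symmetry constraints. -/
theorem exists_vecMulVec_perturbation {A B : Matrix (Fin n) (Fin n) ℂ}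
    (hreg : PencilRegular n A B) {Z : Finset (Option ℂ)} (hZ : none ∈ Z) :
    ∃ (α β : ℂ) (x y : Fin n → ℂ),
      PencilRegular n (A + α • vecMulVec x y) (B + β • vecMulVec x y) ∧
      (∀ μ ∈ Z, ∀ k ≤ n, minorOrderAt n k (A + α • vecMulVec x y) (B + β • vecMulVec x y) μ
        = minorOrderAt n (k - 1) A B μ) ∧
      ∀ z, (pencilPoly n A B).eval z ≠ 0 →
        (pencilPoly n (A + α • vecMulVec x y) (B + β • vecMulVec x y)).rootMultiplicity z ≤ 1 := by
  classical
  obtain ⟨α, hα⟩ := Infinite.exists_notMem_finset (Z.eraseNone.image fun z => -z)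
  have hα' : ∀ μ ∈ Z, ∀ z, μ = some z → α + z ≠ 0 := by
    rintro _ hμ z rfl h0
    exact hα (Finset.mem_image.mpr ⟨z, Finset.mem_eraseNone.mpr hμ, by linear_combination -h0⟩)
  obtain ⟨P, hP0, hP⟩ := exists_mvPolynomial_forall_mem (ι := Fin n ⊕ Fin n)
    (Z ×ˢ Finset.range n) (fun μk Y =>
      minorOrderAt n (μk.2 + 1) (A + α • vecMulVec (Y ∘ Sum.inl) (Y ∘ Sum.inr))
        (B + (1 : ℂ) • vecMulVec (Y ∘ Sum.inl) (Y ∘ Sum.inr)) μk.1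
          ≤ minorOrderAt n μk.2 A B μk.1) (by
    rintro ⟨μ, k⟩ hμk
    obtain ⟨hμ, hk⟩ := Finset.mem_product.mp hμk
    exact exists_mvPolynomial_vecMulVec_minorOrderAt_le hreg (hα' μ hμ) (Finset.mem_range.mp hk))
  obtain ⟨Y, hY⟩ := exists_eval_ne_zero hP0
  obtain ⟨h, hh⟩ := exists_pencilPoly_add_smul_vecMulVec A B α 1 (Y ∘ Sum.inl) (Y ∘ Sum.inr)
  obtain ⟨T, hT⟩ := exists_finset_eval_eq_zero_of_multiple_root (pencilPoly n A B) h
  let φ : ℂ[X] := MvPolynomial.aeval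
    (Sum.elim (fun i => C (Y (Sum.inl i)) * X) (fun j => C (Y (Sum.inr j)))) P
  have hφ : ∀ t, φ.eval t
      = MvPolynomial.eval (Sum.elim (t • (Y ∘ Sum.inl)) (Y ∘ Sum.inr)) P := by
    intro t
    rw [eval_aeval_mvPolynomial]
    congr 2
    ext i
    rcases i with i | i
    · simp only [Sum.elim_inl, eval_mul, eval_C, eval_X, Pi.smul_apply, Function.comp_apply,
        smul_eq_mul, mul_comm]
    · simp only [Sum.elim_inr, eval_C, Function.comp_apply]
  have hφ0 : φ ≠ 0 := by
    intro h0
    have := hφ 1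
    rw [h0, eval_zero, one_smul, Sum.elim_comp_inl_inr] at this
    exact hY this.symm
  obtain ⟨t, ht⟩ := Infinite.exists_notMem_finset (T ∪ φ.roots.toFinset)
  rw [Finset.mem_union, not_or, Multiset.mem_toFinset, mem_roots hφ0, IsRoot.def, hφ] at ht
  have hle := hP _ ht.2
  simp only [Sum.elim_comp_inl, Sum.elim_comp_inr] at hle
  have heq : ∀ μ ∈ Z, ∀ k ≤ n, minorOrderAt n k
      (A + α • vecMulVec (t • (Y ∘ Sum.inl)) (Y ∘ Sum.inr))
      (B + (1 : ℂ) • vecMulVec (t • (Y ∘ Sum.inl)) (Y ∘ Sum.inr)) μ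
        = minorOrderAt n (k - 1) A B μ := by
    intro μ hμ k hk
    refine le_antisymm ?_ (minorOrderAt_sub_le (isDyadSum_one_smul_vecMulVec _ _ _ _) A B k μ)
    cases k with
    | zero => simp [minorOrderAt_zero]
    | succ k => exact hle (μ, k) (Finset.mem_product.mpr ⟨hμ, Finset.mem_range.mpr hk⟩)
  have hreg' : PencilRegular n (A + α • vecMulVec (t • (Y ∘ Sum.inl)) (Y ∘ Sum.inr))
      (B + (1 : ℂ) • vecMulVec (t • (Y ∘ Sum.inl)) (Y ∘ Sum.inr)) := by
    refine pencilRegular_of_minorOrderAt_none_ne_top ?_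
    rw [heq none hZ n le_rfl]
    exact minorOrderAt_ne_top hreg _ (Nat.sub_le _ _)
  refine ⟨α, 1, _, _, hreg', heq, fun z hz => ?_⟩
  by_contra! hcon
  rw [PencilRegular, hh] at hreg'
  rw [hh] at hcon
  exact hz (hT t ht.1 hreg' z hcon)

end RankOneStep

section RankR

variable {n : ℕ}

theorem exists_sum_vecMulVec_perturbation {A B : Matrix (Fin n) (Fin n) ℂ}
    (hreg : PencilRegular n A B) {Z : Finset (Option ℂ)} (hZ : none ∈ Z)
    (hroot : ∀ z, (pencilPoly n A B).eval z = 0 → some z ∈ Z) (r : ℕ) :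
    ∃ (α β : Fin r → ℂ) (x y : Fin r → Fin n → ℂ),
      PencilRegular n (A + ∑ c, α c • vecMulVec (x c) (y c))
        (B + ∑ c, β c • vecMulVec (x c) (y c)) ∧
      (∀ μ ∈ Z, ∀ k ≤ n, minorOrderAt n k (A + ∑ c, α c • vecMulVec (x c) (y c))
        (B + ∑ c, β c • vecMulVec (x c) (y c)) μ = minorOrderAt n (k - r) A B μ) ∧
      ∀ z, some z ∉ Z → (pencilPoly n (A + ∑ c, α c • vecMulVec (x c) (y c))
        (B + ∑ c, β c • vecMulVec (x c) (y c))).rootMultiplicity z ≤ 1 := by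
  classical
  induction r with
  | zero =>
    refine ⟨0, 0, 0, 0, by simpa using hreg, by simp, fun z hz => ?_⟩
    have : (pencilPoly n A B).rootMultiplicity z = 0 :=
      rootMultiplicity_eq_zero fun h => hz (hroot z h)
    simp [this]
  | succ r ih =>
    obtain ⟨α, β, x, y, hreg', heq, hsimple⟩ := ih
    set A' := A + ∑ c, α c • vecMulVec (x c) (y c)
    set B' := B + ∑ c, β c • vecMulVec (x c) (y c)
    obtain ⟨α₀, β₀, x₀, y₀, hreg'', heq', hsimple'⟩ := exists_vecMulVec_perturbation hreg'
      (Z := Z ∪ (pencilPoly n A' B').roots.toFinset.image some) (Finset.mem_union_left _ hZ)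
    refine ⟨Fin.snoc α α₀, Fin.snoc β β₀, Fin.snoc (α := fun _ => Fin n → ℂ) x x₀,
      Fin.snoc (α := fun _ => Fin n → ℂ) y y₀, ?_⟩
    simp only [Fin.sum_univ_castSucc, Fin.snoc_castSucc, Fin.snoc_last, ← add_assoc]
    refine ⟨hreg'', fun μ hμ k hk => ?_, fun z hz => ?_⟩
    · rw [heq' μ (Finset.mem_union_left _ hμ) k hk, heq μ hμ _ ((Nat.sub_le _ _).trans hk),
        Nat.sub_sub, Nat.add_comm 1 r]
    · by_cases h0 : (pencilPoly n A' B').eval z = 0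
      · have h1 := heq' (some z) (Finset.mem_union_right _ (Finset.mem_image_of_mem _
          (Multiset.mem_toFinset.mpr ((mem_roots hreg').mpr h0)))) n le_rfl
        have h2 := minorOrderAt_mono hreg' (some z) (Nat.sub_le n 1) le_rfl
        rw [← h1, minorOrderAt_card_some hreg'', minorOrderAt_card_some hreg'] at h2
        exact (Nat.cast_le.mp h2).trans (hsimple z hz)
      · exact hsimple' z h0

end RankR

section SimpleRoots

theorem separable_iff_rootMultiplicity_le_one {q : ℂ[X]} (hq : q ≠ 0) :
    q.Separable ↔ ∀ z, q.rootMultiplicity z ≤ 1 := by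
  classical
  rw [← nodup_roots_iff_of_splits hq (IsAlgClosed.splits q), Multiset.nodup_iff_count_le_one]
  simp only [count_roots]

theorem natDegree_derivative_eq_sub_one (q : ℂ[X]) :
    (derivative q).natDegree = q.natDegree - 1 := by
  by_cases h : q.natDegree = 0
  · simp [derivative_of_natDegree_zero h, h]
  · refine le_antisymm (natDegree_derivative_le q) (le_natDegree_of_ne_zero ?_)
    rw [coeff_derivative, Nat.sub_add_cancel (Nat.pos_of_ne_zero h)]
    refine mul_ne_zero ?_ (Nat.cast_add_one_ne_zero _)
    rw [coeff_natDegree, leadingCoeff_ne_zero]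
    rintro rfl
    exact h natDegree_zero

theorem exists_mvPolynomial_separable {ι : Type*} (𝒬 : (MvPolynomial ι ℂ)[X]) (Y₀ : ι → ℂ)
    (h : (𝒬.map (MvPolynomial.eval Y₀)).Separable) :
    ∃ P : MvPolynomial ι ℂ, MvPolynomial.eval Y₀ P ≠ 0 ∧ ∀ Y, MvPolynomial.eval Y P ≠ 0 →
      (𝒬.map (MvPolynomial.eval Y)).natDegree = (𝒬.map (MvPolynomial.eval Y₀)).natDegree →
      (𝒬.map (MvPolynomial.eval Y)).Separable := by
  by_cases hd : (𝒬.map (MvPolynomial.eval Y₀)).natDegree = 0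
  · refine ⟨𝒬.coeff 0, ?_, fun Y hY hdeg => ?_⟩
    · rw [← coeff_map]
      intro h0
      rw [eq_C_of_natDegree_eq_zero hd, h0, C_0] at h
      exact h.ne_zero rfl
    · rw [hd] at hdeg
      rw [← coeff_map] at hY
      rw [eq_C_of_natDegree_eq_zero hdeg]
      exact (separable_C _).mpr (isUnit_iff_ne_zero.mpr hY)
  · set d := (𝒬.map (MvPolynomial.eval Y₀)).natDegree
    have key : ∀ Y : ι → ℂ, MvPolynomial.eval Y (resultant 𝒬 (derivative 𝒬) d (d - 1))
        = resultant (𝒬.map (MvPolynomial.eval Y)) (derivative (𝒬.map (MvPolynomial.eval Y)))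
          d (d - 1) := by
      intro Y
      rw [derivative_map, resultant_map_map]
    refine ⟨resultant 𝒬 (derivative 𝒬) d (d - 1), ?_, fun Y hY hdeg => ?_⟩
    · rw [key]
      have := resultant_ne_zero _ _ h
      rwa [natDegree_derivative_eq_sub_one] at this
    · rw [key] at hY
      obtain ⟨a, b, -, -, hab⟩ := exists_mul_add_mul_eq_C_resultant
        (𝒬.map (MvPolynomial.eval Y)) (derivative (𝒬.map (MvPolynomial.eval Y))) hdeg.le
        (n := d - 1) (by rw [natDegree_derivative_eq_sub_one, hdeg]) (Or.inl hd)
      rw [separable_def']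
      refine ⟨C (resultant (𝒬.map (MvPolynomial.eval Y))
        (derivative (𝒬.map (MvPolynomial.eval Y))) d (d - 1))⁻¹ * a, C (resultant
          (𝒬.map (MvPolynomial.eval Y)) (derivative (𝒬.map (MvPolynomial.eval Y)))
            d (d - 1))⁻¹ * b, ?_⟩
      rw [mul_assoc, mul_assoc, ← mul_add, mul_comm a, mul_comm b, hab, ← C_mul,
        inv_mul_cancel₀ hY, C_1]

theorem natTrailingDegree_reflect {p : ℂ[X]} (hp : p ≠ 0) {m : ℕ} (hm : p.natDegree ≤ m) :
    (reflect m p).natTrailingDegree = m - p.natDegree := by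
  refine le_antisymm (natTrailingDegree_le_of_ne_zero ?_) (le_natTrailingDegree ?_ ?_)
  · rw [coeff_reflect, revAt_le (Nat.sub_le _ _), Nat.sub_sub_self hm, coeff_natDegree]
    exact leadingCoeff_ne_zero.mpr hp
  · rwa [Ne, reflect_eq_zero_iff]
  · intro k hk
    rw [coeff_reflect, revAt_le (by lia)]
    exact coeff_eq_zero_of_natDegree_lt (by lia)

theorem natDegree_pencilPoly {n : ℕ} {A B : Matrix (Fin n) (Fin n) ℂ}
    (h : PencilRegular n A B) :
    (pencilPoly n A B).natDegree = n - (pencilPoly n B A).rootMultiplicity 0 := by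
  have := pencilPoly_natDegree_le A B
  rw [rootMultiplicity_eq_natTrailingDegree', pencilPoly_swap A B, natTrailingDegree_reflect h this]
  lia

theorem rootMultiplicity_prod_X_sub_C_pow (S : Finset ℂ) (m : ℂ → ℕ) (z : ℂ) :
    (∏ w ∈ S, (X - C w) ^ m w).rootMultiplicity z = if z ∈ S then m z else 0 := by
  classical
  rw [← count_roots, roots_prod _ _ (Finset.prod_ne_zero_iff.mpr fun w _ =>
    pow_ne_zero _ (X_sub_C_ne_zero w)), Multiset.count_bind]
  simp only [roots_pow, roots_X_sub_C, Multiset.count_nsmul, Multiset.count_singleton]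
  change ∑ w ∈ S, _ = _
  simp

theorem prod_X_sub_C_pow_dvd {p : ℂ[X]} {S : Finset ℂ} {m : ℂ → ℕ}
    (h : ∀ z ∈ S, m z ≤ p.rootMultiplicity z) : (∏ w ∈ S, (X - C w) ^ m w) ∣ p := by
  refine Finset.prod_dvd_of_coprime (fun a _ b _ hab => ?_) fun z hz =>
    (pow_dvd_pow _ (h z hz)).trans (pow_rootMultiplicity_dvd p z)
  exact (pairwise_coprime_X_sub_C Function.injective_id hab).pow

end SimpleRoots

section Generic

variable {n : ℕ}

/-- The conditions on a perturbation `A' + λB'` of `A + λB` that turn out to be generic. -/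
def GoodAt (r : ℕ) (A B : Matrix (Fin n) (Fin n) ℂ) (Z : Finset (Option ℂ))
    (A' B' : Matrix (Fin n) (Fin n) ℂ) : Prop :=
  PencilRegular n A' B' ∧
    ∀ μ ∈ Z, ∀ k ≤ n, minorOrderAt n k A' B' μ = minorOrderAt n (k - r) A B μ

theorem exists_mvPolynomial_goodAt {ι : Type*} {r : ℕ} {A B : Matrix (Fin n) (Fin n) ℂ}
    (hreg : PencilRegular n A B) {Z : Finset (Option ℂ)} (hZ : none ∈ Z)
    (𝓐 𝓑 : Matrix (Fin n) (Fin n) (MvPolynomial ι ℂ))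
    (hdy : ∀ Y, ∃ E F, IsDyadSum r E F ∧ 𝓐.map (MvPolynomial.eval Y) = A + E ∧
      𝓑.map (MvPolynomial.eval Y) = B + F) (Y₀ : ι → ℂ)
    (hY₀ : GoodAt r A B Z (𝓐.map (MvPolynomial.eval Y₀)) (𝓑.map (MvPolynomial.eval Y₀))) :
    ∃ P : MvPolynomial ι ℂ, P ≠ 0 ∧ ∀ Y, MvPolynomial.eval Y P ≠ 0 →
      GoodAt r A B Z (𝓐.map (MvPolynomial.eval Y)) (𝓑.map (MvPolynomial.eval Y)) := by
  obtain ⟨P, hP0, hP⟩ := exists_mvPolynomial_forall_mem (ι := ι)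
    (Z ×ˢ Finset.range (n + 1)) (fun μk Y =>
      minorOrderAt n μk.2 (𝓐.map (MvPolynomial.eval Y)) (𝓑.map (MvPolynomial.eval Y)) μk.1
          ≤ minorOrderAt n (μk.2 - r) A B μk.1) (by
    rintro ⟨μ, k⟩ hμk
    obtain ⟨hμ, hk⟩ := Finset.mem_product.mp hμk
    have hk' : k ≤ n := Nat.lt_succ_iff.mp (Finset.mem_range.mp hk)
    obtain ⟨P, hP, h⟩ := exists_mvPolynomial_minorOrderAt_le 𝓐 𝓑 k
      (minorOrderAt_ne_top hreg μ ((Nat.sub_le k r).trans hk')) μ Y₀ (hY₀.2 μ hμ k hk').le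
    exact ⟨P, fun h0 => hP (by rw [h0, map_zero]), h⟩)
  refine ⟨P, hP0, fun Y hY => ?_⟩
  have heq : ∀ μ ∈ Z, ∀ k ≤ n, minorOrderAt n k (𝓐.map (MvPolynomial.eval Y))
      (𝓑.map (MvPolynomial.eval Y)) μ = minorOrderAt n (k - r) A B μ := by
    intro μ hμ k hk
    refine le_antisymm (hP Y hY (μ, k) (Finset.mem_product.mpr
      ⟨hμ, Finset.mem_range.mpr (Nat.lt_succ_of_le hk)⟩)) ?_
    obtain ⟨E, F, hEF, hE, hF⟩ := hdy Y
    rw [hE, hF]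
    exact minorOrderAt_sub_le hEF A B k μ
  refine ⟨pencilRegular_of_minorOrderAt_none_ne_top ?_, heq⟩
  rw [heq none hZ n le_rfl]
  exact minorOrderAt_ne_top hreg _ (Nat.sub_le _ _)

/-- Factorization of the determinant of a good perturbation into its prescribed part and a
remaining factor without prescribed roots. -/
theorem GoodAt.pencilPoly_eq_mul {r : ℕ} {A B A' B' : Matrix (Fin n) (Fin n) ℂ}
    {Z : Finset (Option ℂ)} (h : GoodAt r A B Z A' B') {W : ℂ[X]}
    (hW : W = ∏ w ∈ Z.eraseNone,
      (X - C w) ^ (minorOrderAt n (n - r) A B (some w)).toNat) :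
    pencilPoly n A' B' = W * (pencilPoly n A' B' /ₘ W) ∧
      (∀ z, some z ∈ Z → (pencilPoly n A' B' /ₘ W).rootMultiplicity z = 0) ∧
      ∀ z, some z ∉ Z → (pencilPoly n A' B' /ₘ W).rootMultiplicity z
        = (pencilPoly n A' B').rootMultiplicity z := by
  have hm : ∀ z ∈ Z.eraseNone, (pencilPoly n A' B').rootMultiplicity z
      = (minorOrderAt n (n - r) A B (some z)).toNat := by
    intro z hz
    rw [← h.2 _ (Finset.mem_eraseNone.mp hz) n le_rfl, minorOrderAt_card_some h.1, ENat.toNat_natCast]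
  have hmonic : W.Monic := by
    rw [hW]
    exact monic_prod_of_monic _ _ fun w _ => (monic_X_sub_C w).pow _
  have hdvd : W ∣ pencilPoly n A' B' := by
    rw [hW]
    exact prod_X_sub_C_pow_dvd fun z hz => (hm z hz).ge
  have hmul : pencilPoly n A' B' = W * (pencilPoly n A' B' /ₘ W) := by
    obtain ⟨q, hq⟩ := hdvd
    rw [hq, mul_divByMonic_cancel_left q hmonic]
  have hrm : ∀ z, (pencilPoly n A' B').rootMultiplicity z
      = W.rootMultiplicity z + (pencilPoly n A' B' /ₘ W).rootMultiplicity z := by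
    intro z
    rw [← rootMultiplicity_mul (hmul ▸ h.1), ← hmul]
  refine ⟨hmul, fun z hz => ?_, fun z hz => ?_⟩
  · have h1 := hrm z
    rw [hm z (Finset.mem_eraseNone.mpr hz), hW, rootMultiplicity_prod_X_sub_C_pow,
      if_pos (Finset.mem_eraseNone.mpr hz), ← hW] at h1
    lia
  · rw [hrm z]
    conv_rhs => rw [hW, rootMultiplicity_prod_X_sub_C_pow,
      if_neg (fun h => hz (Finset.mem_eraseNone.mp h)), ← hW, zero_add]

theorem GoodAt.natDegree_eq {r : ℕ} {A B A' B' A'' B'' : Matrix (Fin n) (Fin n) ℂ}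
    {Z : Finset (Option ℂ)} (hZ : none ∈ Z) (h' : GoodAt r A B Z A' B')
    (h'' : GoodAt r A B Z A'' B'') :
    (pencilPoly n A' B').natDegree = (pencilPoly n A'' B'').natDegree := by
  rw [natDegree_pencilPoly h'.1, natDegree_pencilPoly h''.1]
  congr 1
  rw [← Nat.cast_inj (R := ℕ∞), ← minorOrderAt_card_none h'.1, ← minorOrderAt_card_none h''.1,
    h'.2 none hZ n le_rfl, h''.2 none hZ n le_rfl]

/-- A polynomial family of perturbations that are sums of `r` dyads and that attains all pencils
`∑ (α_c + λ β_c) x_c y_cᵀ` is generically good and generically creates only simple new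
eigenvalues. -/
theorem exists_mvPolynomial_goodAt_and_simple {ι : Type*} {r : ℕ}
    {A B : Matrix (Fin n) (Fin n) ℂ} (hreg : PencilRegular n A B) {Z : Finset (Option ℂ)}
    (hZ : none ∈ Z) (hroot : ∀ z, (pencilPoly n A B).eval z = 0 → some z ∈ Z)
    (𝓔 𝓕 : Matrix (Fin n) (Fin n) (MvPolynomial ι ℂ))
    (hdy : ∀ Y, IsDyadSum r (𝓔.map (MvPolynomial.eval Y)) (𝓕.map (MvPolynomial.eval Y)))
    (hsurj : ∀ (α β : Fin r → ℂ) (x y : Fin r → Fin n → ℂ), ∃ Y,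
      𝓔.map (MvPolynomial.eval Y) = ∑ c, α c • vecMulVec (x c) (y c) ∧
      𝓕.map (MvPolynomial.eval Y) = ∑ c, β c • vecMulVec (x c) (y c)) :
    ∃ P : MvPolynomial ι ℂ, P ≠ 0 ∧ ∀ Y, MvPolynomial.eval Y P ≠ 0 →
      GoodAt r A B Z (A + 𝓔.map (MvPolynomial.eval Y)) (B + 𝓕.map (MvPolynomial.eval Y)) ∧
      ∀ z, some z ∉ Z → (pencilPoly n (A + 𝓔.map (MvPolynomial.eval Y))
        (B + 𝓕.map (MvPolynomial.eval Y))).rootMultiplicity z ≤ 1 := by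
  obtain ⟨α, β, x, y, hreg₀, heq₀, hsimple₀⟩ :=
    exists_sum_vecMulVec_perturbation hreg hZ hroot r
  obtain ⟨Y₀, hE₀, hF₀⟩ := hsurj α β x y
  have hev : ∀ (M : Matrix (Fin n) (Fin n) ℂ) (𝓜 : Matrix (Fin n) (Fin n) (MvPolynomial ι ℂ))
      (Y : ι → ℂ), (M.map MvPolynomial.C + 𝓜).map (MvPolynomial.eval Y)
        = M + 𝓜.map (MvPolynomial.eval Y) := by
    intro M 𝓜 Y
    ext1 i j
    simp
  have hgood₀ : GoodAt r A B Z (A + 𝓔.map (MvPolynomial.eval Y₀))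
      (B + 𝓕.map (MvPolynomial.eval Y₀)) := by
    rw [hE₀, hF₀]
    exact ⟨hreg₀, heq₀⟩
  obtain ⟨P₁, hP₁, hP₁good⟩ := exists_mvPolynomial_goodAt hreg hZ (A.map MvPolynomial.C + 𝓔)
    (B.map MvPolynomial.C + 𝓕) (fun Y => ⟨_, _, hdy Y, hev A 𝓔 Y, hev B 𝓕 Y⟩) Y₀
    (by rwa [hev, hev])
  simp only [hev] at hP₁good
  obtain ⟨W, hW⟩ : ∃ W : ℂ[X], W = ∏ w ∈ Z.eraseNone,
    (X - C w) ^ (minorOrderAt n (n - r) A B (some w)).toNat := ⟨_, rfl⟩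
  have hmonic : W.Monic := by
    rw [hW]
    exact monic_prod_of_monic _ _ fun w _ => (monic_X_sub_C w).pow _
  let 𝒬 : (MvPolynomial ι ℂ)[X] :=
    (pencilMat (A.map MvPolynomial.C + 𝓔) (B.map MvPolynomial.C + 𝓕)).det /ₘ
      W.map MvPolynomial.C
  have h𝒬 : ∀ Y : ι → ℂ, 𝒬.map (MvPolynomial.eval Y)
      = pencilPoly n (A + 𝓔.map (MvPolynomial.eval Y)) (B + 𝓕.map (MvPolynomial.eval Y))
        /ₘ W := by
    intro Y
    have h1 : (W.map MvPolynomial.C).map (MvPolynomial.eval Y) = W := by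
      have h2 : (MvPolynomial.eval Y).comp MvPolynomial.C = RingHom.id ℂ :=
        RingHom.ext fun c => MvPolynomial.eval_C c
      rw [Polynomial.map_map, h2, Polynomial.map_id]
    rw [map_divByMonic _ (hmonic.map _), h1, ← coe_mapRingHom, RingHom.map_det,
      RingHom.mapMatrix_apply, pencilMat_map, hev, hev, pencilPoly_eq]
  have hne : ∀ A' B', GoodAt r A B Z A' B' → pencilPoly n A' B' /ₘ W ≠ 0 := by
    intro A' B' h h0
    have := (h.pencilPoly_eq_mul hW).1
    rw [h0, mul_zero] at this
    exact h.1 this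
  have hsep : (𝒬.map (MvPolynomial.eval Y₀)).Separable := by
    rw [h𝒬, separable_iff_rootMultiplicity_le_one (hne _ _ hgood₀)]
    intro z
    by_cases hz : some z ∈ Z
    · rw [(hgood₀.pencilPoly_eq_mul hW).2.1 z hz]
      exact zero_le_one
    · rw [(hgood₀.pencilPoly_eq_mul hW).2.2 z hz, hE₀, hF₀]
      exact hsimple₀ z hz
  obtain ⟨P₂, hP₂, hP₂sep⟩ := exists_mvPolynomial_separable 𝒬 Y₀ hsep
  refine ⟨P₁ * P₂, mul_ne_zero hP₁ fun h0 => hP₂ (by rw [h0, map_zero]), fun Y hY => ?_⟩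
  rw [map_mul] at hY
  have hgood := hP₁good Y (left_ne_zero_of_mul hY)
  refine ⟨hgood, fun z hz => ?_⟩
  have hs := hP₂sep Y (right_ne_zero_of_mul hY) (by
    rw [h𝒬, h𝒬, natDegree_divByMonic _ hmonic, natDegree_divByMonic _ hmonic,
      hgood.natDegree_eq hZ hgood₀])
  rw [h𝒬, separable_iff_rootMultiplicity_le_one (hne _ _ hgood)] at hs
  rw [← (hgood.pencilPoly_eq_mul hW).2.2 z hz]
  exact hs z

end Generic

section Complexification

variable {n l s : ℕ} {R S : Type*} [CommRing R] [Algebra ℂ R] [CommRing S] [Algebra ℂ S]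

/-- The vector entry `Y_re + i Y_im`, for parameters in a `ℂ`-algebra. -/
noncomputable def holEnt (Y : IdxR l s n → R) (t : IdxC l s n) : R :=
  Y (.inr (.inl t)) + Y (.inr (.inr t)) * algebraMap ℂ R Complex.I

/-- The formal conjugate `Y_re - i Y_im` of `holEnt`. -/
noncomputable def antiEnt (Y : IdxR l s n → R) (t : IdxC l s n) : R :=
  Y (.inr (.inl t)) - Y (.inr (.inr t)) * algebraMap ℂ R Complex.I

/-- Constant coefficient of the scalar pencil multiplying `u_k u_k^*`. -/
noncomputable def dyadCoeffA (sc : StructClass) (a b : R) : R :=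
  match sc with
  | .skewHermitian => algebraMap ℂ R Complex.I * a
  | .starEven => a
  | .starOdd => algebraMap ℂ R Complex.I * a
  | .starPalindromic => a - algebraMap ℂ R Complex.I * b
  | .starAntiPalindromic => a + algebraMap ℂ R Complex.I * b

/-- Leading coefficient of the scalar pencil multiplying `u_k u_k^*`. -/
noncomputable def dyadCoeffB (sc : StructClass) (a b : R) : R :=
  match sc with
  | .skewHermitian => algebraMap ℂ R Complex.I * b
  | .starEven => algebraMap ℂ R Complex.I * b
  | .starOdd => b
  | .starPalindromic => a + algebraMap ℂ R Complex.I * b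
  | .starAntiPalindromic => -a + algebraMap ℂ R Complex.I * b

/-- Constant coefficient of the vector pencil multiplying `v_j^*` from the left. -/
def crossA (sc : StructClass) (γ δ : R) : R :=
  match sc with
  | .skewHermitian => -γ
  | .starEven => γ
  | .starOdd => -γ
  | .starPalindromic => δ
  | .starAntiPalindromic => -δ

/-- Leading coefficient of the vector pencil multiplying `v_j^*` from the left. -/
def crossB (sc : StructClass) (γ δ : R) : R :=
  match sc with
  | .skewHermitian => -δ
  | .starEven => -δ
  | .starOdd => δ
  | .starPalindromic => γ
  | .starAntiPalindromic => -γ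

/-- `PhiStA` with parameters in an arbitrary `ℂ`-algebra. -/
noncomputable def complexPhiA (sc : StructClass) (Y : IdxR l s n → R) :
    Matrix (Fin n) (Fin n) R :=
  (∑ i : Fin l, dyadCoeffA sc (Y (.inl (.inl i))) (Y (.inl (.inr i))) •
      vecMulVec (fun k => holEnt Y (.inl i, k)) (fun k => antiEnt Y (.inl i, k)))
  + ∑ j : Fin s, (vecMulVec (fun k => holEnt Y (.inr (.inl j), k))
        (fun k => antiEnt Y (.inr (.inr (.inl j)), k))
      + vecMulVec (fun k => crossA sc (holEnt Y (.inr (.inr (.inl j)), k))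
          (holEnt Y (.inr (.inr (.inr j)), k)))
        (fun k => antiEnt Y (.inr (.inl j), k)))

/-- `PhiStB` with parameters in an arbitrary `ℂ`-algebra. -/
noncomputable def complexPhiB (sc : StructClass) (Y : IdxR l s n → R) :
    Matrix (Fin n) (Fin n) R :=
  (∑ i : Fin l, dyadCoeffB sc (Y (.inl (.inl i))) (Y (.inl (.inr i))) •
      vecMulVec (fun k => holEnt Y (.inl i, k)) (fun k => antiEnt Y (.inl i, k)))
  + ∑ j : Fin s, (vecMulVec (fun k => holEnt Y (.inr (.inl j), k))
        (fun k => antiEnt Y (.inr (.inr (.inr j)), k))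
      + vecMulVec (fun k => crossB sc (holEnt Y (.inr (.inr (.inl j)), k))
          (holEnt Y (.inr (.inr (.inr j)), k)))
        (fun k => antiEnt Y (.inr (.inl j), k)))

theorem complexPhiA_map (φ : R →ₐ[ℂ] S) (sc : StructClass) (Y : IdxR l s n → R) :
    (complexPhiA sc Y).map φ = complexPhiA sc (φ ∘ Y) := by
  ext1 i j
  cases sc <;> simp [complexPhiA, Matrix.sum_apply, vecMulVec_apply, holEnt, antiEnt, dyadCoeffA,
    crossA]

theorem complexPhiB_map (φ : R →ₐ[ℂ] S) (sc : StructClass) (Y : IdxR l s n → R) :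
    (complexPhiB sc Y).map φ = complexPhiB sc (φ ∘ Y) := by
  ext1 i j
  cases sc <;> simp [complexPhiB, Matrix.sum_apply, vecMulVec_apply, holEnt, antiEnt, dyadCoeffB,
    crossB]

theorem complexPhiA_X_map_eval (sc : StructClass) (Y : IdxR l s n → ℂ) :
    (complexPhiA (n := n) sc (MvPolynomial.X (R := ℂ))).map (MvPolynomial.eval Y)
      = complexPhiA sc Y := by
  have h := complexPhiA_map (MvPolynomial.aeval (R := ℂ) Y) sc MvPolynomial.X
  rwa [show MvPolynomial.aeval (R := ℂ) Y ∘ MvPolynomial.X = Y from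
    funext fun t => MvPolynomial.aeval_X _ _] at h

theorem complexPhiB_X_map_eval (sc : StructClass) (Y : IdxR l s n → ℂ) :
    (complexPhiB (n := n) sc (MvPolynomial.X (R := ℂ))).map (MvPolynomial.eval Y)
      = complexPhiB sc Y := by
  have h := complexPhiB_map (MvPolynomial.aeval (R := ℂ) Y) sc MvPolynomial.X
  rwa [show MvPolynomial.aeval (R := ℂ) Y ∘ MvPolynomial.X = Y from
    funext fun t => MvPolynomial.aeval_X _ _] at h

theorem star_holEnt_ofReal (y : IdxR l s n → ℝ) (t : IdxC l s n) :
    star (holEnt (fun i => (y i : ℂ)) t) = antiEnt (fun i => (y i : ℂ)) t := by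
  simp [holEnt, antiEnt, sub_eq_add_neg]

theorem cEnt_eq_holEnt (y : IdxR l s n → ℝ) (t : IdxC l s n) :
    cEnt y t = holEnt (fun i => (y i : ℂ)) t := rfl

theorem PhiStA_eq_complexPhiA (sc : StructClass) (y : IdxR l s n → ℝ) :
    PhiStA n l s sc y = complexPhiA sc (fun t => (y t : ℂ)) := by
  ext1 i j
  cases sc <;> simp only [PhiStA, complexPhiA, Matrix.add_apply, Matrix.neg_apply,
    Matrix.sum_apply, Matrix.smul_apply, vecMulVec_apply, Pi.star_apply, star_holEnt_ofReal, dyadCoeffA,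
    crossA, cEnt_eq_holEnt, sub_eq_add_neg, neg_mul] <;> rfl

theorem PhiStB_eq_complexPhiB (sc : StructClass) (y : IdxR l s n → ℝ) :
    PhiStB n l s sc y = complexPhiB sc (fun t => (y t : ℂ)) := by
  ext1 i j
  cases sc <;> simp only [PhiStB, complexPhiB, Matrix.add_apply, Matrix.neg_apply,
    Matrix.sum_apply, Matrix.smul_apply, vecMulVec_apply, Pi.star_apply, star_holEnt_ofReal, dyadCoeffB,
    crossB, cEnt_eq_holEnt, sub_eq_add_neg, neg_mul] <;> rfl

theorem isDyadSum_complexPhi (sc : StructClass) (Y : IdxR l s n → ℂ) :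
    IsDyadSum (l + 2 * s) (complexPhiA sc Y) (complexPhiB sc Y) := by
  refine ⟨Fin l ⊕ (Fin s ⊕ Fin s), inferInstance,
    Sum.elim (fun i => dyadCoeffA sc (Y (.inl (.inl i))) (Y (.inl (.inr i))) •
        fun k => holEnt Y (.inl i, k))
      (Sum.elim (fun j k => holEnt Y (.inr (.inl j), k))
        (fun j k => crossA sc (holEnt Y (.inr (.inr (.inl j)), k))
          (holEnt Y (.inr (.inr (.inr j)), k)))),
    Sum.elim (fun i => dyadCoeffB sc (Y (.inl (.inl i))) (Y (.inl (.inr i))) •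
        fun k => holEnt Y (.inl i, k))
      (Sum.elim (fun j k => holEnt Y (.inr (.inl j), k))
        (fun j k => crossB sc (holEnt Y (.inr (.inr (.inl j)), k))
          (holEnt Y (.inr (.inr (.inr j)), k)))),
    Sum.elim (fun i k => antiEnt Y (.inl i, k))
      (Sum.elim (fun j k => antiEnt Y (.inr (.inr (.inl j)), k))
        (fun j k => antiEnt Y (.inr (.inl j), k))),
    Sum.elim (fun i k => antiEnt Y (.inl i, k))
      (Sum.elim (fun j k => antiEnt Y (.inr (.inr (.inr j)), k))
        (fun j k => antiEnt Y (.inr (.inl j), k))), ?_, ?_, ?_, ?_⟩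
  · simp only [Fintype.card_sum, Fintype.card_fin]
    lia
  · rintro (i | j | j)
    · exact Or.inr rfl
    · exact Or.inl rfl
    · exact Or.inr rfl
  · simp only [complexPhiA, Fintype.sum_sum_type, Sum.elim_inl, Sum.elim_inr, smul_vecMulVec,
      Finset.sum_add_distrib]
  · simp only [complexPhiB, Fintype.sum_sum_type, Sum.elim_inl, Sum.elim_inr, smul_vecMulVec,
      Finset.sum_add_distrib]

theorem exists_dyadCoeff_eq (sc : StructClass) (α β : ℂ) :
    ∃ a b : ℂ, dyadCoeffA sc a b = α ∧ dyadCoeffB sc a b = β := by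
  have hI : Complex.I * Complex.I = -1 := Complex.I_mul_I
  cases sc
  · exact ⟨-Complex.I * α, -Complex.I * β, by
      constructor <;> simp only [dyadCoeffA, dyadCoeffB, Algebra.algebraMap_self, RingHom.id_apply]
      · linear_combination -α * hI
      · linear_combination -β * hI⟩
  · exact ⟨α, -Complex.I * β, rfl, by
      simp only [dyadCoeffB, Algebra.algebraMap_self, RingHom.id_apply]
      linear_combination -β * hI⟩
  · exact ⟨-Complex.I * α, β, by
      simp only [dyadCoeffA, Algebra.algebraMap_self, RingHom.id_apply]
      linear_combination -α * hI, rfl⟩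
  · exact ⟨(α + β) / 2, -Complex.I * (β - α) / 2, by
      constructor <;> simp only [dyadCoeffA, dyadCoeffB, Algebra.algebraMap_self, RingHom.id_apply]
      · linear_combination (β - α) / 2 * hI
      · linear_combination -(β - α) / 2 * hI⟩
  · exact ⟨(α - β) / 2, -Complex.I * (α + β) / 2, by
      constructor <;> simp only [dyadCoeffA, dyadCoeffB, Algebra.algebraMap_self, RingHom.id_apply]
      · linear_combination -(α + β) / 2 * hI
      · linear_combination -(α + β) / 2 * hI⟩

theorem exists_cross_eq (sc : StructClass) (p q : ℂ) :
    ∃ γ δ : ℂ, crossA sc γ δ = p ∧ crossB sc γ δ = q := by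
  cases sc
  · exact ⟨-p, -q, neg_neg p, neg_neg q⟩
  · exact ⟨p, -q, rfl, neg_neg q⟩
  · exact ⟨-p, q, neg_neg p, rfl⟩
  · exact ⟨q, p, rfl, rfl⟩
  · exact ⟨-q, -p, neg_neg p, neg_neg q⟩

theorem exists_holEnt_antiEnt_eq (a b : Fin l → ℂ) (p q : IdxC l s n → ℂ) :
    ∃ Y : IdxR l s n → ℂ, (∀ i, Y (.inl (.inl i)) = a i) ∧ (∀ i, Y (.inl (.inr i)) = b i) ∧
      (∀ t, holEnt Y t = p t) ∧ ∀ t, antiEnt Y t = q t := by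
  refine ⟨Sum.elim (Sum.elim a b) (Sum.elim (fun t => (p t + q t) / 2)
    (fun t => -Complex.I * (p t - q t) / 2)), fun _ => rfl, fun _ => rfl, fun t => ?_, fun t => ?_⟩
  all_goals
    simp only [holEnt, antiEnt, Sum.elim_inl, Sum.elim_inr, Algebra.algebraMap_self,
      RingHom.id_apply]
  · linear_combination -(p t - q t) / 2 * Complex.I_mul_I
  · linear_combination (p t - q t) / 2 * Complex.I_mul_I

theorem exists_complexPhi_eq_sum (sc : StructClass) {r : ℕ} (hr : l + 2 * s = r)
    (α β : Fin r → ℂ) (x y : Fin r → Fin n → ℂ) : ∃ Y : IdxR l s n → ℂ,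
      complexPhiA sc Y = ∑ c, α c • vecMulVec (x c) (y c) ∧
      complexPhiB sc Y = ∑ c, β c • vecMulVec (x c) (y c) := by
  obtain ⟨e⟩ : Nonempty (Fin l ⊕ (Fin s ⊕ Fin s) ≃ Fin r) :=
    ⟨Fintype.equivFinOfCardEq (by simp only [Fintype.card_sum, Fintype.card_fin]; lia)⟩
  choose a b hab using fun i => exists_dyadCoeff_eq sc (α (e (.inl i))) (β (e (.inl i)))
  choose γ δ hγδ using fun (j : Fin s) (k : Fin n) => exists_cross_eq sc
    (α (e (.inr (.inr j))) * x (e (.inr (.inr j))) k)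
    (β (e (.inr (.inr j))) * x (e (.inr (.inr j))) k)
  obtain ⟨Y, ha, hb, hp, hq⟩ := exists_holEnt_antiEnt_eq a b
    (fun t : IdxC l s n => Sum.elim (fun i => x (e (.inl i)))
      (Sum.elim (fun j => x (e (.inr (.inl j)))) (Sum.elim γ δ)) t.1 t.2)
    (fun t : IdxC l s n => Sum.elim (fun i => y (e (.inl i)))
      (Sum.elim (fun j => y (e (.inr (.inr j))))
        (Sum.elim (fun j => α (e (.inr (.inl j))) • y (e (.inr (.inl j))))
          (fun j => β (e (.inr (.inl j))) • y (e (.inr (.inl j)))))) t.1 t.2)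
  refine ⟨Y, ?_, ?_⟩
  all_goals
    rw [← e.sum_comp]
    ext1 i j
    simp only [complexPhiA, complexPhiB, ha, hb, hp, hq, Sum.elim_inl, Sum.elim_inr, hab, hγδ,
      Fintype.sum_sum_type, Finset.sum_add_distrib, Matrix.add_apply, Matrix.sum_apply,
      Matrix.smul_apply, vecMulVec_apply, Pi.smul_apply, smul_eq_mul, mul_assoc, mul_left_comm]

end Complexification

section RealPoints

variable {ι : Type*}

theorem exists_real_mvPolynomial_pair (P : MvPolynomial ι ℂ) :
    ∃ p q : MvPolynomial ι ℝ,
      P = p.map Complex.ofRealHom + MvPolynomial.C Complex.I * q.map Complex.ofRealHom := by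
  induction P using MvPolynomial.induction_on with
  | C c =>
    refine ⟨MvPolynomial.C c.re, MvPolynomial.C c.im, ?_⟩
    simp only [MvPolynomial.map_C, ← map_mul, ← map_add]
    congr 1
    simp [mul_comm Complex.I]
  | add P Q hP hQ =>
    obtain ⟨p, q, rfl⟩ := hP
    obtain ⟨p', q', rfl⟩ := hQ
    refine ⟨p + p', q + q', ?_⟩
    simp only [map_add]
    ring
  | mul_X P i hP =>
    obtain ⟨p, q, rfl⟩ := hP
    refine ⟨p * MvPolynomial.X i, q * MvPolynomial.X i, ?_⟩
    simp only [map_mul, MvPolynomial.map_X]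
    ring

theorem isGenericR_setOf_eval_ne_zero {ι : Type} [Fintype ι] {P : MvPolynomial ι ℂ}
    (hP : P ≠ 0) :
    IsGenericR ι {y | MvPolynomial.eval (fun i => (y i : ℂ)) P ≠ 0} := by
  classical
  obtain ⟨p, q, hpq⟩ := exists_real_mvPolynomial_pair P
  refine ⟨{p, q}, ?_, fun y hy => ?_⟩
  · by_contra! h
    refine hP ?_
    rw [hpq, h p (by simp), h q (by simp)]
    simp
  · have hmap : ∀ f : MvPolynomial ι ℝ, MvPolynomial.eval (fun i => (y i : ℂ))
        (f.map Complex.ofRealHom) = (MvPolynomial.eval y f : ℂ) := by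
      intro f
      have := MvPolynomial.map_eval Complex.ofRealHom y f
      simpa [Function.comp_def] using this.symm
    simp only [Set.mem_compl_iff, Set.mem_ofPred_eq, not_not] at hy
    rw [hpq, map_add, map_mul, hmap, hmap, MvPolynomial.eval_C] at hy
    have hre := congrArg Complex.re hy
    have him := congrArg Complex.im hy
    simp at hre him
    simp [hre, him]

end RealPoints

section Eigenvalues

variable {n : ℕ}

theorem minorOrderAt_card {A B : Matrix (Fin n) (Fin n) ℂ} (h : PencilRegular n A B)
    (μ : Option ℂ) : minorOrderAt n n A B μ = (algMultAt n A B μ : ℕ∞) := by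
  cases μ with
  | none => exact minorOrderAt_card_none h
  | some z => exact minorOrderAt_card_some h z

theorem isEigenvalue_iff_algMultAt_ne_zero {A B : Matrix (Fin n) (Fin n) ℂ}
    (h : PencilRegular n A B) (μ : Option ℂ) : IsEigenvalue n A B μ ↔ algMultAt n A B μ ≠ 0 := by
  obtain ⟨e, -, hsum⟩ := exists_minorOrderAt_eq_sum h μ
  have hcard : algMultAt n A B μ = ∑ i ∈ Finset.range n, e i := by
    rw [← Nat.cast_inj (R := ℕ∞), ← minorOrderAt_card h, hsum n le_rfl]
  have hinc : ∀ k < n, (minorOrderAt n (k + 1) A B μ - minorOrderAt n k A B μ).toNat = e k := by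
    intro k hk
    rw [hsum _ hk, hsum _ hk.le, ← ENat.natCast_sub, ENat.toNat_natCast, Finset.sum_range_succ]
    lia
  rw [IsEigenvalue, not_iff_not, hcard, Finset.sum_eq_zero_iff, pmAt_eq,
    Multiset.filter_eq_nil]
  simp only [Multiset.mem_map, Multiset.mem_range, Finset.mem_range]
  refine ⟨fun H k hk => ?_, ?_⟩
  · have := H (e k) ⟨k, hk, hinc k hk⟩
    lia
  · rintro H _ ⟨k, hk, rfl⟩
    rw [hinc k hk, H k hk]
    exact lt_irrefl 0

end Eigenvalues

/-- **Generic change under low-rank structure-preserving perturbations of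
skew-Hermitian, *-alternating, *-palindromic and *-anti-palindromic pencils.**
If `L(λ) = A + λB` is a regular pencil with one of the five symmetry structures,
with pairwise distinct eigenvalues `Λ 1, …, Λ κ` (finite or infinite) with partial
multiplicities `nn i 0 ≥ … ≥ nn i (g i − 1) > 0`, then for `1 ≤ r` and
`s ≤ ⌊r/2⌋`, with `ℓ = r − 2s`, there is a generic set
`G_s ⊆ ℝ^{2ℓ+2(r+s)n}` such that for all parameter tuples in `G_s`, with
`E = Φ_s` of the tuple: `L + E` is regular; the partial multiplicities of `L + E`
at `Λ i` are exactly `nn i r ≥ … ≥ nn i (g i − 1)` (so if `r ≥ g i` then `Λ i`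
is not an eigenvalue of `L + E`); and every eigenvalue of `L + E` that is not an
eigenvalue of `L` is simple. -/
theorem generic_low_rank_perturbation_star_structures
    (n κ r s : ℕ) (hr : 1 ≤ r) (hs : s ≤ r / 2)
    (sc : StructClass)
    (A B : Matrix (Fin n) (Fin n) ℂ)
    (hstruct : HasStruct n sc A B)
    (hreg : PencilRegular n A B)
    (Λ : Fin κ → Option ℂ) (hΛ : Function.Injective Λ)
    (heig : ∀ μ : Option ℂ, IsEigenvalue n A B μ ↔ ∃ i, Λ i = μ)
    (g : Fin κ → ℕ) (nn : Fin κ → ℕ → ℕ)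
    (hmono : ∀ i, ∀ j k : ℕ, j ≤ k → nn i k ≤ nn i j)
    (hgpos : ∀ i, ∀ j : ℕ, 0 < nn i j ↔ j < g i)
    (hpm : ∀ i, pmAt n A B (Λ i) = (Multiset.range (g i)).map (nn i)) :
    ∃ G : Set (IdxR (r - 2 * s) s n → ℝ), IsGenericR (IdxR (r - 2 * s) s n) G ∧
      ∀ y ∈ G,
        PencilRegular n (A + PhiStA n (r - 2 * s) s sc y) (B + PhiStB n (r - 2 * s) s sc y) ∧
        (∀ i, pmAt n (A + PhiStA n (r - 2 * s) s sc y) (B + PhiStB n (r - 2 * s) s sc y) (Λ i)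
            = (Multiset.range (g i - r)).map fun j => nn i (r + j)) ∧
        (∀ μ : Option ℂ,
          IsEigenvalue n (A + PhiStA n (r - 2 * s) s sc y) (B + PhiStB n (r - 2 * s) s sc y) μ →
          ¬ IsEigenvalue n A B μ →
          algMultAt n (A + PhiStA n (r - 2 * s) s sc y)
            (B + PhiStB n (r - 2 * s) s sc y) μ = 1) := by
  classical
  have hls : r - 2 * s + 2 * s = r := by lia
  obtain ⟨Z, hZnone, hZroot⟩ : ∃ Z : Finset (Option ℂ), none ∈ Z ∧
      ∀ z, (pencilPoly n A B).eval z = 0 → some z ∈ Z :=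
    ⟨insert none ((pencilPoly n A B).roots.toFinset.image some), Finset.mem_insert_self _ _,
      fun z hz => Finset.mem_insert_of_mem (Finset.mem_image_of_mem _
        (Multiset.mem_toFinset.mpr ((mem_roots hreg).mpr hz)))⟩
  obtain ⟨P, hP0, hP⟩ := exists_mvPolynomial_goodAt_and_simple (r := r) hreg hZnone hZroot
    (complexPhiA (n := n) (l := r - 2 * s) (s := s) sc (MvPolynomial.X (R := ℂ)))
    (complexPhiB sc MvPolynomial.X)
    (fun Y => by
      have := isDyadSum_complexPhi sc Y
      rwa [hls, ← complexPhiA_X_map_eval, ← complexPhiB_X_map_eval] at this)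
    (fun α β x y => by
      simp only [complexPhiA_X_map_eval, complexPhiB_X_map_eval]
      exact exists_complexPhi_eq_sum sc hls α β x y)
  refine ⟨_, isGenericR_setOf_eval_ne_zero hP0, fun y hy => ?_⟩
  obtain ⟨hgood, hsimple⟩ := hP _ hy
  rw [complexPhiA_X_map_eval, complexPhiB_X_map_eval, ← PhiStA_eq_complexPhiA, ← PhiStB_eq_complexPhiB] at hgood hsimple
  refine ⟨hgood.1, fun i => ?_, fun μ hμ hμ' => ?_⟩
  · refine pmAt_eq_of_minorOrderAt_eq hreg (Λ i) r (g i) (nn i) (hgood.2 _ ?_) (hmono i)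
      (hgpos i) (hpm i)
    have hi := (isEigenvalue_iff_algMultAt_ne_zero hreg (Λ i)).mp ((heig _).mpr ⟨i, rfl⟩)
    cases hz : Λ i with
    | none => exact hZnone
    | some z =>
      rw [hz] at hi
      exact hZroot z ((rootMultiplicity_pos hreg).mp (Nat.pos_of_ne_zero hi))
  · rw [isEigenvalue_iff_algMultAt_ne_zero hgood.1] at hμ
    rw [isEigenvalue_iff_algMultAt_ne_zero hreg, not_not] at hμ'
    have hμZ : μ ∉ Z := by
      intro hμZ
      have h1 := minorOrderAt_mono hreg μ (Nat.sub_le n r) le_rfl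
      rw [← hgood.2 μ hμZ n le_rfl, minorOrderAt_card hgood.1, minorOrderAt_card hreg, hμ',
        Nat.cast_le] at h1
      exact hμ (Nat.le_zero.mp h1)
    cases μ with
    | none => exact absurd hZnone hμZ
    | some z => exact le_antisymm (hsimple z hμZ) (Nat.pos_of_ne_zero hμ)
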